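/- arXiv:1007.1276 — 8 statements merged into one kernel-verified Lean document; each statement's English description precedes it below -/
import Mathlib

section
/- Proposition 2.3 (estimate for the non-differentiating operator O_*, in σ-representation). There exists a constant C > 0, depending only on n, s, γ, C_Φ and c_b, such that for every kernel b satisfying the standing kernel assumptions, every measurable g satisfying Assumption U with constant C_g > 0, and all measurable f, h : ℝⁿ → ℝ, one has ∫∫∫ B(v-v_*,σ) |g(v_*)| |f(v') h(v')| · | (|v'-v_*| / |v-v_*|)^{n+γ} − 1 | dσ dv_* dv ≤ C · C_g · |f|_{L²_γ} |h|_{L²_γ}, as an inequality of values in [0,∞] (the integrand is defined for v ≠ v_*, i.e. Lebesgue-almost everywhere; note |v'-v_*| = |v-v_*|·cos(θ/2) ≤ |v-v_*| on the support of b). -/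
open MeasureTheory Real Set Metric
open scoped ENNReal RealInnerProductSpace

noncomputable section

/-- `ℝⁿ` with the Euclidean structure. -/
abbrev V (n : ℕ) := EuclideanSpace ℝ (Fin n)

/-- the Japanese bracket `⟨v⟩ = √(1+|v|²)`. -/
def jap {n : ℕ} (v : V n) : ℝ := Real.sqrt (1 + ‖v‖ ^ 2)

/-- the post-collisional velocity `v' = (v+v_*)/2 + (|v-v_*|/2)σ`. -/
def vprime {n : ℕ} (v vs σ : V n) : V n :=
  (2:ℝ)⁻¹ • (v + vs) + (‖v - vs‖ / 2) • σ

/-- the anisotropic metric `d(v,v') = √(|v-v'|² + ¼(|v|²-|v'|²)²)` on the lifted paraboloid. -/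
def anisoDist {n : ℕ} (v v' : V n) : ℝ :=
  Real.sqrt (‖v - v'‖ ^ 2 + 4⁻¹ * (‖v‖ ^ 2 - ‖v'‖ ^ 2) ^ 2)

/-- The standing assumptions on the angular kernel `b`: measurability, nonnegativity,
vanishing for deviation angles `θ ∈ (π/2, π]`, and the two-sided power bound
`c_b θ^{-(1+2s)} ≤ sin^{n-2}θ · b(cos θ) ≤ c_b⁻¹ θ^{-(1+2s)}` on `(0, π/2]`. -/
def KernelAssumptions (n : ℕ) (s cb : ℝ) (b : ℝ → ℝ) : Prop :=
  Measurable b ∧ (∀ t : ℝ, 0 ≤ b t) ∧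
  (∀ θ : ℝ, θ ∈ Set.Ioc (π / 2) π → b (Real.cos θ) = 0) ∧
  (∀ θ : ℝ, θ ∈ Set.Ioc 0 (π / 2) →
    cb * θ ^ (-(1 + 2 * s)) ≤ Real.sin θ ^ ((n : ℝ) - 2) * b (Real.cos θ) ∧
    Real.sin θ ^ ((n : ℝ) - 2) * b (Real.cos θ) ≤ cb⁻¹ * θ ^ (-(1 + 2 * s)))

/-- The Boltzmann collision kernel `B(v-v_*,σ) = C_Φ |v-v_*|^γ b(⟨(v-v_*)/|v-v_*|, σ⟩)`. -/
def Bker {n : ℕ} (CΦ γ : ℝ) (b : ℝ → ℝ) (v vs σ : V n) : ℝ :=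
  CΦ * ‖v - vs‖ ^ γ * b ⟪‖v - vs‖⁻¹ • (v - vs), σ⟫

/-- the surface measure on the unit sphere `S^{n-1}`. -/
def sphMeas (n : ℕ) : Measure (Metric.sphere (0 : V n) 1) :=
  (volume : Measure (V n)).toSphere

/-- the weighted squared `L²` norm `|f|²_{L²_ℓ}`, as a value in `[0,∞]`. -/
def L2e {n : ℕ} (ℓ : ℝ) (f : V n → ℝ) : ℝ≥0∞ :=
  ∫⁻ v : V n, ENNReal.ofReal (jap v ^ ℓ * f v ^ 2)

/-- Assumption U: with `i = 1` for `s ∈ (0,1/2)` and `i = 2` for `s ∈ [1/2,1)`,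
`∫ |v-v_*|^a ⟨v_*⟩^i |g(v_*)| dv_* ≤ C_g ⟨v⟩^a` for all `v` and all `a ∈ [γ, γ+2s]`. -/
def AssumptionU {n : ℕ} (s γ Cg : ℝ) (g : V n → ℝ) : Prop :=
  ∀ v : V n, ∀ a ∈ Set.Icc γ (γ + 2 * s),
    (∫⁻ vs : V n, ENNReal.ofReal
        (‖v - vs‖ ^ a * jap vs ^ (if s < 2⁻¹ then (1:ℝ) else 2) * |g vs|)) ≤
      ENNReal.ofReal (Cg * jap v ^ a)

lemma Phi_bound (p : ℝ) (c : ℝ) (h0 : 0 < c) (h1 : c ≤ 1) (hp : 0 < p) :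
    |c ^ p - 1| ≤ max 1 p * (1 - c) := by
  have hle : c ^ p ≤ 1 := Real.rpow_le_one h0.le h1 hp.le
  rw [abs_of_nonpos (by linarith)]
  rcases le_total p 1 with h | h
  · have : c ^ (1:ℝ) ≤ c ^ p := Real.rpow_le_rpow_of_exponent_ge h0 h1 h
    rw [Real.rpow_one] at this
    rw [max_eq_left h]; linarith
  · have := one_add_mul_self_le_rpow_one_add (s := c - 1) (by linarith) h
    rw [max_eq_right h]
    have e : 1 + (c - 1) = c := by ring
    rw [e] at this
    nlinarith

lemma kernel_bound (n : ℕ) (hn : 2 ≤ n) (s cb p a : ℝ) (hs : 0 < s) (hcb : 0 < cb)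
    (hp : 0 < p) (ha : (n:ℝ) - 3 + 2 * s ≤ a) :
    ∃ C : ℝ, 0 < C ∧ ∀ b : ℝ → ℝ, KernelAssumptions n s cb b → ∀ t : ℝ, 0 ≤ t → t < 1 →
      b t * |(√((1 + t) / 2)) ^ p - 1| ≤ C * (√(2 - 2 * t)) ^ (-a) := by
  have hm : (0:ℝ) ≤ (n:ℝ) - 2 := by
    have : (2:ℝ) ≤ n := by exact_mod_cast hn
    linarith
  refine ⟨cb⁻¹ * 2 ^ ((n:ℝ) - 2) * max 1 p * 2 ^ (a - ((n:ℝ) - 3 + 2 * s)), by positivity, ?_⟩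
  intro b hb t ht0 ht1
  obtain ⟨-, hb0, -, hbb⟩ := hb
  set θ := Real.arccos t with hθ
  have hcos : Real.cos θ = t := Real.cos_arccos (by linarith) ht1.le
  have hθ0 : 0 < θ := Real.arccos_pos.2 ht1
  have hθ1 : θ ≤ π / 2 := Real.arccos_le_pi_div_two.2 ht0
  obtain ⟨-, hub⟩ := hbb θ ⟨hθ0, hθ1⟩
  rw [hcos] at hub
  set d := √(2 - 2 * t) with hd
  have hd0 : 0 < d := Real.sqrt_pos.2 (by linarith)
  have hd2 : d ^ 2 = 2 - 2 * t := Real.sq_sqrt (by linarith)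
  have hdle : d ≤ 2 := by nlinarith
  have hdθ : d ≤ θ := by
    have := Real.one_sub_sq_div_two_le_cos (x := θ)
    rw [hcos] at this
    exact abs_le_of_sq_le_sq' (by nlinarith) hθ0.le |>.2
  have hsin : d / 2 ≤ Real.sin θ := by
    have h1 := Real.sin_sq_add_cos_sq θ
    rw [hcos] at h1
    have h2 : 0 ≤ Real.sin θ := Real.sin_nonneg_of_nonneg_of_le_pi hθ0.le (by linarith [Real.pi_pos])
    exact abs_le_of_sq_le_sq' (by nlinarith) h2 |>.2
  set m := (n:ℝ) - 2 with hmdef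
  have hbt : b t ≤ cb⁻¹ * d ^ (-(1 + 2 * s)) * (2 ^ m * d ^ (-m)) := by
    have h1 : (d / 2) ^ m * b t ≤ cb⁻¹ * d ^ (-(1 + 2 * s)) := by
      calc (d / 2) ^ m * b t ≤ Real.sin θ ^ m * b t := by
            have := hb0 t
            gcongr
        _ ≤ cb⁻¹ * θ ^ (-(1 + 2 * s)) := hub
        _ ≤ cb⁻¹ * d ^ (-(1 + 2 * s)) := by
            have := Real.rpow_le_rpow_of_nonpos hd0 hdθ (z := -(1 + 2 * s)) (by linarith)
            gcongr
    have h2 : (2:ℝ) ^ m * d ^ (-m) * (d / 2) ^ m = 1 := by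
      rw [Real.div_rpow hd0.le (by norm_num), Real.rpow_neg hd0.le]
      have : (0:ℝ) < 2 ^ m := by positivity
      have : (0:ℝ) < d ^ m := by positivity
      field_simp
    calc b t = (2:ℝ) ^ m * d ^ (-m) * ((d / 2) ^ m * b t) := by rw [← mul_assoc, h2, one_mul]
      _ ≤ (2:ℝ) ^ m * d ^ (-m) * (cb⁻¹ * d ^ (-(1 + 2 * s))) := by gcongr
      _ = _ := by ring
  have hc0 : 0 < √((1 + t) / 2) := Real.sqrt_pos.2 (by linarith)
  have hc1 : √((1 + t) / 2) ≤ 1 := Real.sqrt_le_one.2 (by linarith)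
  have hct : t ≤ √((1 + t) / 2) := Real.le_sqrt_of_sq_le (by nlinarith)
  have hΦ : |(√((1 + t) / 2)) ^ p - 1| ≤ max 1 p * d ^ (2:ℝ) := by
    refine (Phi_bound p _ hc0 hc1 hp).trans ?_
    have : (0:ℝ) < max 1 p := by positivity
    gcongr
    rw [Real.rpow_two, hd2]; linarith
  calc b t * |(√((1 + t) / 2)) ^ p - 1|
      ≤ (cb⁻¹ * d ^ (-(1 + 2 * s)) * (2 ^ m * d ^ (-m))) * (max 1 p * d ^ (2:ℝ)) := by
        gcongr
    _ = cb⁻¹ * 2 ^ m * max 1 p * (d ^ (-(1 + 2 * s)) * d ^ (-m) * d ^ (2:ℝ)) := by ring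
    _ = cb⁻¹ * 2 ^ m * max 1 p * (d ^ (a - ((n:ℝ) - 3 + 2 * s)) * d ^ (-a)) := by
        rw [← Real.rpow_add hd0, ← Real.rpow_add hd0, ← Real.rpow_add hd0]
        congr 2
        rw [hmdef]; ring
    _ ≤ cb⁻¹ * 2 ^ m * max 1 p * (2 ^ (a - ((n:ℝ) - 3 + 2 * s)) * d ^ (-a)) := by
        have := Real.rpow_le_rpow hd0.le hdle (z := a - ((n:ℝ) - 3 + 2 * s)) (by linarith)
        gcongr
    _ = _ := by ring

open scoped Pointwise in
lemma cap_bound (n : ℕ) (hn : 2 ≤ n) : ∃ C : ℝ, 0 < C ∧ ∀ x : V n, ‖x‖ = 1 →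
    ∀ r : ℝ, 0 < r → r ≤ 2 →
    sphMeas n {σ | ‖x - (σ : V n)‖ ≤ r} ≤ ENNReal.ofReal (C * r ^ ((n:ℝ) - 1)) := by
  set ω := (volume (ball (0 : V n) 1)).toReal with hω
  have hω0 : 0 ≤ ω := ENNReal.toReal_nonneg
  refine ⟨n * 5 * 2 ^ n * (ω + 1), by positivity, ?_⟩
  intro x hx r hr hr2
  have hmeas : MeasurableSet {σ : Metric.sphere (0 : V n) 1 | ‖x - (σ : V n)‖ ≤ r} :=
    measurableSet_le (by fun_prop) (by fun_prop)
  rw [sphMeas, Measure.toSphere_apply' _ hmeas]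
  set N := ⌊1 / r⌋₊ + 1 with hN
  have hsub : Ioo (0:ℝ) 1 • ((fun σ : Metric.sphere (0 : V n) 1 => (σ : V n)) ''
      {σ | ‖x - (σ : V n)‖ ≤ r}) ⊆ ⋃ k ∈ Finset.range N, closedBall ((k * r) • x) (2 * r) := by
    rintro _ ⟨t, ⟨ht0, ht1⟩, _, ⟨σ, hσ, rfl⟩, rfl⟩
    simp only [mem_iUnion]
    refine ⟨⌊t / r⌋₊, ?_, ?_⟩
    · rw [Finset.mem_range, hN, Nat.lt_succ_iff]
      exact Nat.floor_le_floor (by gcongr)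
    · rw [mem_closedBall, dist_eq_norm]
      have h1 : (⌊t / r⌋₊ : ℝ) ≤ t / r := Nat.floor_le (by positivity)
      have h2 : t / r < ⌊t / r⌋₊ + 1 := Nat.lt_floor_add_one _
      rw [le_div_iff₀ hr] at h1
      rw [div_lt_iff₀ hr] at h2
      have e : t • (σ : V n) - ((⌊t / r⌋₊ : ℝ) * r) • x
          = (t - (⌊t / r⌋₊ : ℝ) * r) • x - t • (x - (σ : V n)) := by
        module
      simp only [e]
      refine (norm_sub_le _ _).trans ?_
      rw [norm_smul, norm_smul, hx, Real.norm_eq_abs, Real.norm_eq_abs, abs_of_pos ht0,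
        abs_of_nonneg (by linarith)]
      have hσ' : ‖x - (σ : V n)‖ ≤ r := hσ
      nlinarith [norm_nonneg (x - (σ : V n))]
  have hNr : (N : ℝ) ≤ 5 / r := by
    have : (⌊1 / r⌋₊ : ℝ) ≤ 1 / r := Nat.floor_le (by positivity)
    rw [hN]; push_cast
    rw [le_div_iff₀ hr]
    rw [le_div_iff₀ hr] at this
    linarith
  have hvol : volume (⋃ k ∈ Finset.range N, closedBall (((k:ℝ) * r) • x) (2 * r))
      ≤ ENNReal.ofReal (N * ((2 * r) ^ n * ω)) := by
    refine (measure_biUnion_finset_le _ _).trans ?_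
    have : ∀ k ∈ Finset.range N, volume (closedBall (((k:ℝ) * r) • x) (2 * r))
        = ENNReal.ofReal ((2 * r) ^ n * ω) := by
      intro k _
      rw [Measure.addHaar_closedBall _ _ (by positivity), ENNReal.ofReal_mul (by positivity), hω,
        ENNReal.ofReal_toReal measure_ball_lt_top.ne]
      simp
    rw [Finset.sum_congr rfl this, Finset.sum_const, Finset.card_range, nsmul_eq_mul,
      ENNReal.ofReal_mul (p := (N : ℝ)) (by positivity), ENNReal.ofReal_natCast]
  have hdim : (Module.finrank ℝ (V n) : ℝ≥0∞) = ENNReal.ofReal n := by simp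
  calc _ ≤ ENNReal.ofReal n * ENNReal.ofReal (N * ((2 * r) ^ n * ω)) := by
        rw [hdim]
        gcongr
        exact (measure_mono hsub).trans hvol
    _ = ENNReal.ofReal (n * (N * ((2 * r) ^ n * ω))) := by
        rw [ENNReal.ofReal_mul (p := (n : ℝ)) (by positivity)]
    _ ≤ _ := by
        apply ENNReal.ofReal_le_ofReal
        have e : r ^ ((n:ℝ) - 1) = r ^ n / r := by
          rw [Real.rpow_sub hr, Real.rpow_natCast, Real.rpow_one]
        rw [e]
        calc (n:ℝ) * (N * ((2 * r) ^ n * ω)) ≤ n * ((5 / r) * ((2 * r) ^ n * (ω + 1))) := by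
              gcongr; linarith
          _ = _ := by rw [mul_pow]; ring

lemma sphere_bound (n : ℕ) (hn : 2 ≤ n) (a : ℝ) (ha : 0 < a) (han : a < (n:ℝ) - 1) :
    ∃ C : ℝ, 0 < C ∧ ∀ x : V n, ‖x‖ = 1 →
    ∫⁻ σ : Metric.sphere (0 : V n) 1, ENNReal.ofReal (‖x - (σ : V n)‖ ^ (-a)) ∂(sphMeas n)
      ≤ ENNReal.ofReal C := by
  obtain ⟨C, hC, hcap⟩ := cap_bound n hn
  set q : ℝ := 2 ^ (a - ((n:ℝ) - 1)) with hq
  have hq0 : 0 < q := by positivity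
  have hq1 : q < 1 := Real.rpow_lt_one_of_one_lt_of_neg (by norm_num) (by linarith)
  refine ⟨C * 2 ^ ((n:ℝ) - 1) * (1 - q)⁻¹, by
    have : 0 < 1 - q := by linarith
    positivity, ?_⟩
  intro x hx
  let S : ℕ → Set (Metric.sphere (0 : V n) 1) := fun k => {σ | ‖x - (σ : V n)‖ ≤ 2 * (1/2) ^ k}
  have hS : ∀ k, MeasurableSet (S k) := fun k =>
    measurableSet_le (by fun_prop) (by fun_prop)
  have hpt : ∀ σ : Metric.sphere (0 : V n) 1, ENNReal.ofReal (‖x - (σ : V n)‖ ^ (-a)) ≤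
      ∑' k : ℕ, (S k).indicator (fun _ => ENNReal.ofReal ((2:ℝ) ^ (k * a))) σ := by
    intro σ
    set d := ‖x - (σ : V n)‖ with hd
    have hd0 : 0 ≤ d := norm_nonneg _
    have hd2 : d ≤ 2 := by
      have : ‖(σ : V n)‖ = 1 := by simp
      have := norm_sub_le x (σ : V n)
      linarith
    rcases hd0.eq_or_lt with h | h
    · rw [← h, Real.zero_rpow (by linarith)]; simp
    · obtain ⟨k, hk1, hk2⟩ := exists_nat_pow_near_of_lt_one (x := d / 2) (y := (1/2 : ℝ))
        (by positivity) (by linarith) (by norm_num) (by norm_num)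
      refine le_trans ?_ (ENNReal.le_tsum k)
      have hmem : σ ∈ S k := by
        show d ≤ _
        linarith
      rw [indicator_of_mem hmem]
      apply ENNReal.ofReal_le_ofReal
      have h3 : (1/2 : ℝ) ^ k ≤ d := by rw [pow_succ] at hk1; linarith
      calc d ^ (-a) ≤ ((1/2 : ℝ) ^ k) ^ (-a) :=
            Real.rpow_le_rpow_of_nonpos (by positivity) h3 (by linarith)
        _ = _ := by
            rw [← Real.rpow_natCast, one_div, Real.inv_rpow (by norm_num), Real.inv_rpow (by positivity),
              ← Real.rpow_neg (by positivity), neg_neg, ← Real.rpow_mul (by norm_num)]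
  calc _ ≤ ∫⁻ σ, ∑' k : ℕ, (S k).indicator (fun _ => ENNReal.ofReal ((2:ℝ) ^ (k * a))) σ
        ∂(sphMeas n) := lintegral_mono hpt
    _ = ∑' k : ℕ, ENNReal.ofReal ((2:ℝ) ^ (k * a)) * sphMeas n (S k) := by
        rw [lintegral_tsum (fun k => (measurable_const.indicator (hS k)).aemeasurable)]
        congr 1; ext k
        rw [lintegral_indicator_const (hS k)]
    _ ≤ ∑' k : ℕ, ENNReal.ofReal (C * 2 ^ ((n:ℝ) - 1) * q ^ k) := by
        refine ENNReal.tsum_le_tsum fun k => ?_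
        have hk1 : ((1/2 : ℝ)) ^ k ≤ 1 := pow_le_one₀ (by norm_num) (by norm_num)
        refine (mul_le_mul_right (hcap x hx (2 * (1/2) ^ k) (by positivity) (by linarith)) _).trans ?_
        rw [← ENNReal.ofReal_mul (by positivity)]
        apply ENNReal.ofReal_le_ofReal
        apply le_of_eq
        have e1 : ((1/2 : ℝ) ^ k) ^ ((n:ℝ) - 1) = 2 ^ (-(k * ((n:ℝ) - 1))) := by
          rw [← Real.rpow_natCast, one_div, Real.inv_rpow (by norm_num), Real.inv_rpow (by positivity),
              ← Real.rpow_mul (by norm_num), Real.rpow_neg (by norm_num)]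
        have e2 : q ^ k = 2 ^ (k * a) * 2 ^ (-(k * ((n:ℝ) - 1))) := by
          rw [hq, ← Real.rpow_natCast, ← Real.rpow_mul (by norm_num), ← Real.rpow_add (by norm_num)]
          congr 1; ring
        rw [Real.mul_rpow (by norm_num) (by positivity), e1, e2]
        ring
    _ = ENNReal.ofReal (∑' k : ℕ, C * 2 ^ ((n:ℝ) - 1) * q ^ k) := by
        rw [ENNReal.ofReal_tsum_of_nonneg (fun k => by positivity)]
        exact (summable_geometric_of_lt_one hq0.le hq1).mul_left _
    _ = _ := by
        rw [tsum_mul_left, tsum_geometric_of_lt_one hq0.le hq1]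

def Tm {n : ℕ} (σ u : V n) : V n := (2:ℝ)⁻¹ • (u + ‖u‖ • σ)

lemma vprime_sub {n : ℕ} (v vs σ : V n) : vprime v vs σ = vs + Tm σ (v - vs) := by
  unfold vprime Tm; module

lemma hasFDerivAt_norm' {n : ℕ} (u : V n) (hu : u ≠ 0) :
    HasFDerivAt (fun u : V n => ‖u‖) (‖u‖⁻¹ • innerSL ℝ u) u := by
  have h := (hasStrictFDerivAt_norm_sq u).hasFDerivAt.sqrt (by simpa using hu)
  have e : (fun y : V n => √(‖y‖ ^ 2)) = fun y => ‖y‖ := by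
    ext y; exact Real.sqrt_sq (norm_nonneg _)
  rw [e] at h
  have e2 : (1 / (2 * √(‖u‖ ^ 2))) • 2 • innerSL ℝ u = ‖u‖⁻¹ • innerSL ℝ u := by
    rw [Real.sqrt_sq (norm_nonneg _)]
    ext y
    simp
    ring
  rw [← e2]
  exact h

lemma hasFDerivAt_Tm {n : ℕ} (σ u : V n) (hu : u ≠ 0) :
    HasFDerivAt (Tm σ) ((2:ℝ)⁻¹ • (ContinuousLinearMap.id ℝ (V n) +
      (‖u‖⁻¹ • innerSL ℝ u).smulRight σ)) u := by
  have h1 : HasFDerivAt (fun u : V n => ‖u‖ • σ) ((‖u‖⁻¹ • innerSL ℝ u).smulRight σ) u :=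
    (hasFDerivAt_norm' u hu).smul_const σ
  exact ((hasFDerivAt_id u).add h1).const_smul (2:ℝ)⁻¹

lemma norm_Tm_sq {n : ℕ} (σ u : V n) (hσ : ‖σ‖ = 1) :
    ‖Tm σ u‖ ^ 2 = (‖u‖ ^ 2 + ‖u‖ * ⟪u, σ⟫) / 2 := by
  rw [Tm, norm_smul, mul_pow, norm_add_sq_real, norm_smul, inner_smul_right, hσ]
  simp
  ring

lemma det_Tm {n : ℕ} (σ u : V n) :
    ((2:ℝ)⁻¹ • (ContinuousLinearMap.id ℝ (V n) +
      (‖u‖⁻¹ • innerSL ℝ u).smulRight σ)).det = (2:ℝ)⁻¹ ^ n * (1 + ‖u‖⁻¹ * ⟪u, σ⟫) := by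
  have e : (((2:ℝ)⁻¹ • (ContinuousLinearMap.id ℝ (V n) +
      (‖u‖⁻¹ • innerSL ℝ u).smulRight σ) : V n →L[ℝ] V n) : V n →ₗ[ℝ] V n) =
      (2:ℝ)⁻¹ • LinearMap.transvection ((‖u‖⁻¹ • innerSL ℝ u : V n →L[ℝ] ℝ) : V n →ₗ[ℝ] ℝ) σ := by
    ext x
    simp [LinearMap.transvection]
  rw [ContinuousLinearMap.det, e, LinearMap.det_smul, LinearMap.transvection.det]
  simp

lemma Tm_inj {n : ℕ} (σ : V n) (hσ : ‖σ‖ = 1) :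
    InjOn (Tm σ) {u : V n | u ≠ 0 ∧ 0 ≤ ⟪u, σ⟫} := by
  have key : ∀ u ∈ {u : V n | u ≠ 0 ∧ 0 ≤ ⟪u, σ⟫},
      ⟪Tm σ u, Tm σ u⟫ = ‖u‖ * ⟪Tm σ u, σ⟫ ∧ 0 < ⟪Tm σ u, σ⟫ := by
    rintro u ⟨hu, hus⟩
    have h0 : 0 < ‖u‖ := norm_pos_iff.2 hu
    have h1 : ⟪Tm σ u, σ⟫ = 2⁻¹ * (⟪u, σ⟫ + ‖u‖) := by
      simp [Tm, inner_smul_left, inner_add_left, hσ]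
      ring
    refine ⟨?_, by rw [h1]; positivity⟩
    rw [h1, real_inner_self_eq_norm_sq, norm_Tm_sq σ u hσ]
    ring
  intro u hu y hy h
  obtain ⟨h1, h2⟩ := key u hu
  obtain ⟨h3, -⟩ := key y hy
  rw [← h, h1] at h3
  have h4 : ‖u‖ = ‖y‖ := mul_right_cancel₀ h2.ne' h3
  unfold Tm at h
  rw [h4] at h
  have := smul_right_injective (V n) (by norm_num : (2:ℝ)⁻¹ ≠ 0) h
  exact add_right_cancel this

lemma cov {n : ℕ} (σ : V n) (hσ : ‖σ‖ = 1) (G : V n → ℝ≥0∞) :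
    ∫⁻ u in {u : V n | u ≠ 0 ∧ 0 ≤ ⟪u, σ⟫}, G (Tm σ u) ≤
      ENNReal.ofReal (2 ^ n) * ∫⁻ w, G w := by
  have hA : MeasurableSet {u : V n | u ≠ 0 ∧ 0 ≤ ⟪u, σ⟫} :=
    by
    have h2 : MeasurableSet {u : V n | 0 ≤ ⟪u, σ⟫} :=
      measurableSet_le measurable_const (by fun_prop)
    exact (measurableSet_singleton (0 : V n)).compl.inter h2
  have h := lintegral_image_eq_lintegral_abs_det_fderiv_mul volume hA
    (fun u hu => (hasFDerivAt_Tm σ u hu.1).hasFDerivWithinAt) (Tm_inj σ hσ) G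
  calc _ ≤ ∫⁻ u in {u : V n | u ≠ 0 ∧ 0 ≤ ⟪u, σ⟫}, ENNReal.ofReal (2 ^ n) *
        (ENNReal.ofReal |((2:ℝ)⁻¹ • (ContinuousLinearMap.id ℝ (V n) +
      (‖u‖⁻¹ • innerSL ℝ u).smulRight σ)).det| * G (Tm σ u)) := by
        refine setLIntegral_mono' hA fun u hu => ?_
        rw [det_Tm, ← mul_assoc, ← ENNReal.ofReal_mul (by positivity)]
        have h1 : 0 ≤ ‖u‖⁻¹ * ⟪u, σ⟫ := mul_nonneg (by positivity) hu.2
        have h2 : 1 ≤ ENNReal.ofReal ((2:ℝ) ^ n * |2⁻¹ ^ n * (1 + ‖u‖⁻¹ * ⟪u, σ⟫)|) := by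
          rw [ENNReal.one_le_ofReal, abs_of_nonneg (by positivity), ← mul_assoc, ← mul_pow]
          norm_num
          exact h1
        calc G (Tm σ u) = 1 * G (Tm σ u) := (one_mul _).symm
          _ ≤ _ := by gcongr
    _ = ENNReal.ofReal (2 ^ n) * ∫⁻ w in Tm σ '' {u : V n | u ≠ 0 ∧ 0 ≤ ⟪u, σ⟫}, G w := by
        rw [h, lintegral_const_mul' _ _ ENNReal.ofReal_ne_top]
    _ ≤ _ := by
        gcongr
        exact Measure.restrict_le_self

lemma geom {n : ℕ} (σ u : V n) (hσ : ‖σ‖ = 1) (hu : u ≠ 0) (t : ℝ)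
    (ht : t = ⟪‖u‖⁻¹ • u, σ⟫) (ht0 : 0 ≤ t) :
    t ≤ 1 ∧ ‖Tm σ u‖ = ‖u‖ * √((1 + t) / 2) ∧
    (t < 1 → 0 < ‖‖Tm σ u‖⁻¹ • Tm σ u - σ‖) ∧
    ‖‖Tm σ u‖⁻¹ • Tm σ u - σ‖ ≤ √(2 - 2 * t) := by
  have h0 : 0 < ‖u‖ := norm_pos_iff.2 hu
  have hin : ⟪u, σ⟫ = ‖u‖ * t := by
    rw [ht, inner_smul_left]
    simp only [conj_trivial]
    field_simp
  have ht1 : t ≤ 1 := by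
    have := real_inner_le_norm u σ
    rw [hin, hσ] at this
    nlinarith
  set c := √((1 + t) / 2) with hc
  have hc2 : c ^ 2 = (1 + t) / 2 := Real.sq_sqrt (by linarith)
  have hc0 : 0 < c := Real.sqrt_pos.2 (by linarith)
  have hn2 : ‖Tm σ u‖ ^ 2 = (‖u‖ * c) ^ 2 := by
    rw [mul_pow, hc2, norm_Tm_sq σ u hσ, hin]
    ring
  have hn : ‖Tm σ u‖ = ‖u‖ * c := by
    rwa [sq_eq_sq₀ (norm_nonneg _) (by positivity)] at hn2
  have hin2 : ⟪Tm σ u, σ⟫ = ‖u‖ * c ^ 2 := by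
    rw [hc2]
    simp [Tm, inner_smul_left, inner_add_left, hσ, hin]
    ring
  have hd : ‖‖Tm σ u‖⁻¹ • Tm σ u - σ‖ ^ 2 = 2 - 2 * c := by
    rw [norm_sub_sq_real, norm_smul, inner_smul_left, hin2, hσ, hn]
    simp
    field_simp
    rw [abs_of_pos hc0]
    ring
  refine ⟨ht1, hn, ?_, ?_⟩
  · intro h
    have : c < 1 := by nlinarith
    have : 0 < ‖‖Tm σ u‖⁻¹ • Tm σ u - σ‖ ^ 2 := by rw [hd]; linarith
    by_contra h'
    have h'' : ‖‖Tm σ u‖⁻¹ • Tm σ u - σ‖ = 0 := le_antisymm (not_lt.1 h') (norm_nonneg _)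
    rw [h''] at this
    simp at this
  · apply Real.le_sqrt_of_sq_le
    rw [hd]
    have : t ≤ c := Real.le_sqrt_of_sq_le (by nlinarith)
    linarith

lemma pointwise_bound (n : ℕ) (hn : 2 ≤ n) (s cb γ a : ℝ) (hs : 0 < s) (hcb : 0 < cb)
    (hp : 0 < (n:ℝ) + γ) (ha : (n:ℝ) - 3 + 2 * s ≤ a) (ha0 : 0 < a) :
    ∃ C : ℝ, 0 < C ∧ ∀ b : ℝ → ℝ, KernelAssumptions n s cb b → ∀ σ u : V n, ‖σ‖ = 1 → u ≠ 0 →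
      0 ≤ ⟪u, σ⟫ →
      ‖u‖ ^ γ * b ⟪‖u‖⁻¹ • u, σ⟫ * |(‖Tm σ u‖ / ‖u‖) ^ ((n:ℝ) + γ) - 1| ≤
        C * (‖Tm σ u‖ ^ γ * ‖‖Tm σ u‖⁻¹ • Tm σ u - σ‖ ^ (-a)) := by
  obtain ⟨C, hC, hk⟩ := kernel_bound n hn s cb ((n:ℝ) + γ) a hs hcb hp ha
  refine ⟨2 ^ |γ| * C, by positivity, ?_⟩
  intro b hb σ u hσ hu hus
  have h0 : 0 < ‖u‖ := norm_pos_iff.2 hu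
  set t := ⟪‖u‖⁻¹ • u, σ⟫ with ht
  have ht0 : 0 ≤ t := by
    rw [ht, inner_smul_left]; simp only [conj_trivial]; positivity
  obtain ⟨ht1, hnT, hpos, hle⟩ := geom σ u hσ hu t ht ht0
  set c := √((1 + t) / 2) with hc
  have hc2 : c ^ 2 = (1 + t) / 2 := Real.sq_sqrt (by linarith)
  have hc0 : 0 < c := Real.sqrt_pos.2 (by linarith)
  have hc1 : c ≤ 1 := Real.sqrt_le_one.2 (by linarith)
  have hc12 : (2:ℝ)⁻¹ ≤ c := Real.le_sqrt_of_sq_le (by nlinarith)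
  have hratio : ‖Tm σ u‖ / ‖u‖ = c := by rw [hnT]; field_simp
  rw [hratio]
  rcases ht1.eq_or_lt with h | h
  · have : c = 1 := by rw [hc, h]; norm_num
    rw [this]
    simp
    positivity
  have hγ : ‖u‖ ^ γ ≤ 2 ^ |γ| * ‖Tm σ u‖ ^ γ := by
    rw [hnT, Real.mul_rpow h0.le hc0.le]
    have : 1 ≤ 2 ^ |γ| * c ^ γ := by
      rcases le_total 0 γ with h | h
      · rw [abs_of_nonneg h, ← Real.mul_rpow (by norm_num) hc0.le]
        exact Real.one_le_rpow (by linarith) h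
      · have h1 : (1:ℝ) ≤ 2 ^ |γ| := Real.one_le_rpow (by norm_num) (abs_nonneg _)
        have h2 : 1 ≤ c ^ γ := Real.one_le_rpow_of_pos_of_le_one_of_nonpos hc0 hc1 h
        nlinarith
    have : 0 < ‖u‖ ^ γ := by positivity
    nlinarith
  have hk' := hk b hb t ht0 h
  have hd := Real.rpow_le_rpow_of_nonpos (hpos h) hle (z := -a) (by linarith)
  have hb0 := hb.2.1 t
  calc ‖u‖ ^ γ * b t * |c ^ ((n:ℝ) + γ) - 1| = ‖u‖ ^ γ * (b t * |c ^ ((n:ℝ) + γ) - 1|) := by ring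
    _ ≤ (2 ^ |γ| * ‖Tm σ u‖ ^ γ) * (C * ‖‖Tm σ u‖⁻¹ • Tm σ u - σ‖ ^ (-a)) := by
        have h3 : b t * |c ^ ((n:ℝ) + γ) - 1| ≤ C * ‖‖Tm σ u‖⁻¹ • Tm σ u - σ‖ ^ (-a) :=
          hk'.trans (mul_le_mul_of_nonneg_left hd hC.le)
        exact mul_le_mul hγ h3 (by positivity) (by positivity)
    _ = _ := by ring

lemma b_neg {n : ℕ} {s cb : ℝ} {b : ℝ → ℝ} (hb : KernelAssumptions n s cb b) (σ u : V n)
    (hσ : ‖σ‖ = 1) (hu : u ≠ 0) (hus : ⟪u, σ⟫ < 0) : b ⟪‖u‖⁻¹ • u, σ⟫ = 0 := by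
  have h0 : 0 < ‖u‖ := norm_pos_iff.2 hu
  set t := ⟪‖u‖⁻¹ • u, σ⟫ with ht
  have htu : t = ‖u‖⁻¹ * ⟪u, σ⟫ := by
    rw [ht, inner_smul_left]; simp only [conj_trivial]
  have ht0 : t < 0 := by
    rw [htu]; exact mul_neg_of_pos_of_neg (by positivity) hus
  have ht1 : -1 ≤ t := by
    have := neg_le_of_abs_le (abs_real_inner_le_norm u σ)
    rw [hσ] at this
    rw [htu, inv_mul_eq_div, le_div_iff₀ h0]
    linarith
  have := hb.2.2.1 (Real.arccos t) ⟨by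
    by_contra h
    exact absurd (Real.arccos_le_pi_div_two.1 (not_lt.1 h)) (not_le.2 ht0), Real.arccos_le_pi t⟩
  rwa [Real.cos_arccos ht1 (by linarith)] at this

lemma one_le_jap {n : ℕ} (v : V n) : 1 ≤ jap v := by
  unfold jap
  rw [Real.one_le_sqrt]
  nlinarith [sq_nonneg ‖v‖]

lemma measurable_jap {n : ℕ} : Measurable (jap : V n → ℝ) := by
  unfold jap; fun_prop

lemma U_gamma {n : ℕ} {s γ Cg : ℝ} (hs : 0 < s) {g : V n → ℝ} (hU : AssumptionU s γ Cg g) (v : V n) :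
    ∫⁻ vs : V n, ENNReal.ofReal (|g vs| * ‖v - vs‖ ^ γ) ≤ ENNReal.ofReal (Cg * jap v ^ γ) := by
  refine le_trans (lintegral_mono fun vs => ?_) (hU v γ ⟨le_rfl, by linarith⟩)
  apply ENNReal.ofReal_le_ofReal
  have h1 : 1 ≤ jap vs ^ (if s < 2⁻¹ then (1:ℝ) else 2) :=
    Real.one_le_rpow (one_le_jap vs) (by split_ifs <;> norm_num)
  have h2 : 0 ≤ |g vs| * ‖v - vs‖ ^ γ := by positivity
  nlinarith

lemma CS_bound {n : ℕ} (γ : ℝ) (f h : V n → ℝ) (hf : Measurable f) (hh : Measurable h) :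
    ∫⁻ v, ENNReal.ofReal (jap v ^ γ * |f v * h v|) ≤
      L2e γ f ^ (2⁻¹ : ℝ) * L2e γ h ^ (2⁻¹ : ℝ) := by
  have hj : Measurable (jap : V n → ℝ) := measurable_jap
  have key := ENNReal.lintegral_mul_le_Lp_mul_Lq (volume : Measure (V n)) Real.HolderConjugate.two_two
    (f := fun v => ENNReal.ofReal (jap v ^ (γ / 2) * |f v|))
    (g := fun v => ENNReal.ofReal (jap v ^ (γ / 2) * |h v|))
    (by fun_prop) (by fun_prop)
  have e : ∀ (k : V n → ℝ) (v : V n), ENNReal.ofReal (jap v ^ (γ / 2) * |k v|) ^ (2:ℝ)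
      = ENNReal.ofReal (jap v ^ γ * k v ^ 2) := by
    intro k v
    have hp : 0 < jap v := lt_of_lt_of_le one_pos (one_le_jap v)
    rw [ENNReal.ofReal_rpow_of_nonneg (by positivity) (by norm_num), Real.rpow_two, mul_pow, sq_abs,
      ← Real.rpow_natCast, ← Real.rpow_mul hp.le]
    norm_num
  simp only [e, one_div] at key
  refine le_trans (le_of_eq ?_) key
  refine lintegral_congr fun v => ?_
  have hp : 0 < jap v := lt_of_lt_of_le one_pos (one_le_jap v)
  simp only [Pi.mul_apply]
  rw [← ENNReal.ofReal_mul (by positivity), abs_mul]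
  congr 1
  have : jap v ^ γ = jap v ^ (γ / 2) * jap v ^ (γ / 2) := by
    rw [← Real.rpow_add hp]; congr 1; ring
  rw [this]; ring

/-- Proposition 2.3 (estimate for the non-differentiating operator `O_*`,
in σ-representation). -/
theorem estimate_Ostar
    (n : ℕ) (hn : 2 ≤ n) (s γ CΦ cb : ℝ)
    (hs : s ∈ Set.Ioo (0:ℝ) 1) (hγ : -(n:ℝ) < γ) (hCΦ : 0 < CΦ) (hcb : 0 < cb) :
    ∃ C : ℝ, 0 < C ∧
      ∀ b : ℝ → ℝ, KernelAssumptions n s cb b →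
      ∀ g : V n → ℝ, Measurable g →
      ∀ Cg : ℝ, 0 < Cg → AssumptionU s γ Cg g →
      ∀ f h : V n → ℝ, Measurable f → Measurable h →
        (∫⁻ v : V n, ∫⁻ vs : V n, ∫⁻ σ : Metric.sphere (0 : V n) 1,
            ENNReal.ofReal (Bker CΦ γ b v vs σ * |g vs| *
              |f (vprime v vs σ) * h (vprime v vs σ)| *
              |(‖vprime v vs σ - vs‖ / ‖v - vs‖) ^ ((n:ℝ) + γ) - 1|) ∂(sphMeas n)) ≤
          ENNReal.ofReal (C * Cg) * L2e γ f ^ (2⁻¹ : ℝ) * L2e γ h ^ (2⁻¹ : ℝ) := by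
  obtain ⟨hs0, hs1⟩ := hs
  have hn2 : (2:ℝ) ≤ n := by exact_mod_cast hn
  set a : ℝ := max ((n:ℝ) - 3 + 2 * s) (1 / 2) with ha
  have ha1 : (n:ℝ) - 3 + 2 * s ≤ a := le_max_left _ _
  have ha0 : 0 < a := lt_of_lt_of_le (by norm_num) (le_max_right _ _)
  have han : a < (n:ℝ) - 1 := max_lt (by linarith) (by linarith)
  obtain ⟨C1, hC1, hpw⟩ := pointwise_bound n hn s cb γ a hs0 hcb (by linarith) ha1 ha0
  obtain ⟨C2, hC2, hsp⟩ := sphere_bound n hn a ha0 han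
  refine ⟨2 ^ n * (CΦ * C1) * C2, by positivity, ?_⟩
  intro b hb g hg Cg hCg hU f h hf hh
  have hbm : Measurable b := hb.1
  have : SFinite (sphMeas n) := by unfold sphMeas; infer_instance
  -- joint measurability
  have hmv : Measurable (fun x : V n × V n × Metric.sphere (0 : V n) 1 =>
      vprime x.1 x.2.1 (x.2.2 : V n)) := by
    unfold vprime; fun_prop
  have hm : Measurable (fun x : V n × V n × Metric.sphere (0 : V n) 1 =>
      ENNReal.ofReal (Bker CΦ γ b x.1 x.2.1 x.2.2 * |g x.2.1| *
              |f (vprime x.1 x.2.1 x.2.2) * h (vprime x.1 x.2.1 x.2.2)| *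
              |(‖vprime x.1 x.2.1 x.2.2 - x.2.1‖ / ‖x.1 - x.2.1‖) ^ ((n:ℝ) + γ) - 1|)) := by
    have h1 : Measurable (fun x : V n × V n × Metric.sphere (0 : V n) 1 =>
      Bker CΦ γ b x.1 x.2.1 x.2.2) := by
      unfold Bker; fun_prop
    fun_prop
  -- bound for fixed vs, σ
  have step1 : ∀ (vs : V n) (σ : Metric.sphere (0 : V n) 1),
      ∫⁻ v : V n, ENNReal.ofReal (Bker CΦ γ b v vs σ * |g vs| *
              |f (vprime v vs σ) * h (vprime v vs σ)| *
              |(‖vprime v vs σ - vs‖ / ‖v - vs‖) ^ ((n:ℝ) + γ) - 1|) ≤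
      ENNReal.ofReal (2 ^ n * (CΦ * C1)) * ∫⁻ v : V n,
        ENNReal.ofReal (|g vs| * ‖v - vs‖ ^ γ) * ENNReal.ofReal |f v * h v| *
          ENNReal.ofReal (‖‖v - vs‖⁻¹ • (v - vs) - (σ : V n)‖ ^ (-a)) := by
    intro vs σ
    have hσ : ‖(σ : V n)‖ = 1 := by simp
    set A : Set (V n) := {u : V n | u ≠ 0 ∧ 0 ≤ ⟪u, (σ : V n)⟫} with hA
    have hAm : MeasurableSet A := by
      have h2 : MeasurableSet {u : V n | 0 ≤ ⟪u, (σ : V n)⟫} :=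
        measurableSet_le measurable_const (by fun_prop)
      exact (measurableSet_singleton (0 : V n)).compl.inter h2
    let G : V n → ℝ≥0∞ := fun w => ENNReal.ofReal (CΦ * C1) *
      (ENNReal.ofReal (|g vs| * ‖w‖ ^ γ) * ENNReal.ofReal |f (w + vs) * h (w + vs)| *
          ENNReal.ofReal (‖‖w‖⁻¹ • w - (σ : V n)‖ ^ (-a)))
    have hne : ∀ᵐ u : V n, u ≠ 0 := by
      have : Nonempty (Fin n) := ⟨⟨0, by omega⟩⟩
      exact Measure.ae_ne volume 0
    rw [← lintegral_add_right_eq_self _ vs]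
    calc _ ≤ ∫⁻ u : V n, A.indicator (fun u => G (Tm (σ : V n) u)) u := by
          refine lintegral_mono_ae ?_
          filter_upwards [hne] with u hu
          simp only [vprime_sub, Bker, add_sub_cancel_right, add_sub_cancel_left]
          rcases lt_or_ge ⟪u, (σ : V n)⟫ 0 with hlt | hge
          · rw [b_neg hb _ u hσ hu hlt]
            simp
          · rw [indicator_of_mem (show u ∈ A from ⟨hu, hge⟩)]
            simp only [G]
            rw [← ENNReal.ofReal_mul (by positivity), ← ENNReal.ofReal_mul (by positivity),
              ← ENNReal.ofReal_mul (by positivity)]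
            apply ENNReal.ofReal_le_ofReal
            have hp := hpw b hb σ u hσ hu hge
            rw [add_comm (Tm (σ : V n) u) vs]
            set F := |f (vs + Tm (σ : V n) u) * h (vs + Tm (σ : V n) u)|
            have hF : 0 ≤ F := abs_nonneg _
            calc _ = (CΦ * |g vs| * F) * (‖u‖ ^ γ * b ⟪‖u‖⁻¹ • u, (σ : V n)⟫ *
                |(‖Tm (σ : V n) u‖ / ‖u‖) ^ ((n:ℝ) + γ) - 1|) := by ring
              _ ≤ (CΦ * |g vs| * F) * _ := mul_le_mul_of_nonneg_left hp (by positivity)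
              _ = _ := by ring
      _ = ∫⁻ u in A, G (Tm (σ : V n) u) := lintegral_indicator hAm _
      _ ≤ ENNReal.ofReal (2 ^ n) * ∫⁻ w, G w := cov _ hσ G
      _ = ENNReal.ofReal (2 ^ n * (CΦ * C1)) * ∫⁻ w : V n,
          (ENNReal.ofReal (|g vs| * ‖w‖ ^ γ) * ENNReal.ofReal |f (w + vs) * h (w + vs)| *
          ENNReal.ofReal (‖‖w‖⁻¹ • w - (σ : V n)‖ ^ (-a))) := by
          rw [lintegral_const_mul' _ _ ENNReal.ofReal_ne_top, ← mul_assoc,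
            ← ENNReal.ofReal_mul (by positivity)]
      _ = _ := by
          congr 1
          rw [← lintegral_add_right_eq_self (fun v : V n =>
            ENNReal.ofReal (|g vs| * ‖v - vs‖ ^ γ) * ENNReal.ofReal |f v * h v| *
            ENNReal.ofReal (‖‖v - vs‖⁻¹ • (v - vs) - (σ : V n)‖ ^ (-a))) vs]
          simp only [add_sub_cancel_right]
  -- bound of the σ integral
  have step2 : ∀ (vs : V n),
      ∫⁻ σ : Metric.sphere (0 : V n) 1, (∫⁻ v : V n,
        ENNReal.ofReal (|g vs| * ‖v - vs‖ ^ γ) * ENNReal.ofReal |f v * h v| *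
          ENNReal.ofReal (‖‖v - vs‖⁻¹ • (v - vs) - (σ : V n)‖ ^ (-a))) ∂(sphMeas n) ≤
      ENNReal.ofReal C2 * ∫⁻ v : V n,
        ENNReal.ofReal (|g vs| * ‖v - vs‖ ^ γ) * ENNReal.ofReal |f v * h v| := by
    intro vs
    have hne : ∀ᵐ v : V n, v ≠ vs := by
      have : Nonempty (Fin n) := ⟨⟨0, by omega⟩⟩
      exact Measure.ae_ne volume vs
    rw [lintegral_lintegral_swap (by fun_prop), ← lintegral_const_mul' _ _ ENNReal.ofReal_ne_top]
    refine lintegral_mono_ae ?_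
    filter_upwards [hne] with v hv
    rw [lintegral_const_mul' _ _ (ENNReal.mul_ne_top ENNReal.ofReal_ne_top ENNReal.ofReal_ne_top),
      mul_comm]
    gcongr
    refine hsp _ ?_
    rw [norm_smul, norm_inv, norm_norm, inv_mul_cancel₀ (norm_ne_zero_iff.2 (sub_ne_zero.2 hv))]
  calc _ = ∫⁻ vs : V n, ∫⁻ v : V n, ∫⁻ σ : Metric.sphere (0 : V n) 1,
            ENNReal.ofReal (Bker CΦ γ b v vs σ * |g vs| *
              |f (vprime v vs σ) * h (vprime v vs σ)| *
              |(‖vprime v vs σ - vs‖ / ‖v - vs‖) ^ ((n:ℝ) + γ) - 1|) ∂(sphMeas n) := by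
        refine lintegral_lintegral_swap ?_
        have := hm.comp (MeasurableEquiv.prodAssoc (α := V n) (β := V n)
          (γ := Metric.sphere (0 : V n) 1)).measurable
        exact (Measurable.lintegral_prod_right' this).aemeasurable
    _ = ∫⁻ vs : V n, ∫⁻ σ : Metric.sphere (0 : V n) 1, (∫⁻ v : V n,
            ENNReal.ofReal (Bker CΦ γ b v vs σ * |g vs| *
              |f (vprime v vs σ) * h (vprime v vs σ)| *
              |(‖vprime v vs σ - vs‖ / ‖v - vs‖) ^ ((n:ℝ) + γ) - 1|)) ∂(sphMeas n) := by
        refine lintegral_congr fun vs => lintegral_lintegral_swap ?_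
        have h2 : Measurable (fun y : V n × Metric.sphere (0 : V n) 1 => (y.1, vs, y.2)) := by
          fun_prop
        exact (hm.comp h2).aemeasurable
    _ ≤ ∫⁻ vs : V n, ENNReal.ofReal (2 ^ n * (CΦ * C1)) * (ENNReal.ofReal C2 * ∫⁻ v : V n,
        ENNReal.ofReal (|g vs| * ‖v - vs‖ ^ γ) * ENNReal.ofReal |f v * h v|) := by
        refine lintegral_mono fun vs => ?_
        refine (lintegral_mono fun σ => step1 vs σ).trans ?_
        rw [lintegral_const_mul' _ _ ENNReal.ofReal_ne_top]
        gcongr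
        exact step2 vs
    _ = ENNReal.ofReal (2 ^ n * (CΦ * C1) * C2) * ∫⁻ v : V n, ∫⁻ vs : V n,
        ENNReal.ofReal (|g vs| * ‖v - vs‖ ^ γ) * ENNReal.ofReal |f v * h v| := by
        rw [lintegral_const_mul' _ _ ENNReal.ofReal_ne_top,
          lintegral_const_mul' _ _ ENNReal.ofReal_ne_top, ← mul_assoc,
          ← ENNReal.ofReal_mul (by positivity), lintegral_lintegral_swap (by fun_prop)]
    _ ≤ ENNReal.ofReal (2 ^ n * (CΦ * C1) * C2) * ∫⁻ v : V n,
        ENNReal.ofReal Cg * ENNReal.ofReal (jap v ^ γ * |f v * h v|) := by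
        gcongr with v
        rw [lintegral_mul_const' _ _ ENNReal.ofReal_ne_top]
        refine (mul_le_mul_left (U_gamma hs0 hU v) _).trans ?_
        have hp : 0 < jap v := lt_of_lt_of_le one_pos (one_le_jap v)
        rw [← ENNReal.ofReal_mul (by positivity), ← ENNReal.ofReal_mul (by positivity), mul_assoc]
    _ ≤ _ := by
        rw [lintegral_const_mul' _ _ ENNReal.ofReal_ne_top, ← mul_assoc,
          ← ENNReal.ofReal_mul (by positivity),
          mul_assoc _ (L2e γ f ^ (2⁻¹ : ℝ))]
        exact mul_le_mul_right (CS_bound γ f h hf hh) _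
end
end

section
/- First-order difference estimate along the paraboloid (inequality (2.6) of the paper). Let n ≥ 1 and let F : ℝ^{n+1} → ℝ be continuously differentiable. Let v, v', v_* ∈ ℝⁿ satisfy ⟨v − v', v' − v_*⟩ = 0 and |v − v'| ≤ 1. Define ζ(θ) := θ v' + (1−θ) v and ζ̃(θ) := (ζ(θ), |ζ(θ)|²/2) ∈ ℝ^{n+1} for θ ∈ [0,1]. Then | F(v', |v'|²/2) − F(v, |v|²/2) | ≤ 2 √(1+|v_*|²) · |v − v'| · ∫₀¹ ‖DF(ζ̃(θ))‖ dθ, where ‖DF(x)‖ is the operator norm of the Fréchet derivative of F at x. -/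
open Real
open scoped RealInnerProductSpace

noncomputable section

/-- `ℝ^{n+1}` realized as `ℝⁿ × ℝ` with the Euclidean (`L²`) product structure. -/
abbrev Vp (n : ℕ) := WithLp 2 (V n × ℝ)

/-- the lift `v ↦ (v, |v|²/2)` of `ℝⁿ` onto the paraboloid in `ℝ^{n+1}`. -/
def lift {n : ℕ} (v : V n) : Vp n := (WithLp.equiv 2 (V n × ℝ)).symm (v, ‖v‖ ^ 2 / 2)

/-- Chain rule along the lifted segment, in an abstract inner product space. -/
theorem hasDerivAt_comp_segment {E : Type*} [NormedAddCommGroup E] [InnerProductSpace ℝ E]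
    (G : E × ℝ → ℝ) (L : E × ℝ →L[ℝ] ℝ) (v v' : E) (θ : ℝ)
    (hG : HasFDerivAt G L (θ • v' + (1 - θ) • v, ‖θ • v' + (1 - θ) • v‖ ^ 2 / 2)) :
    HasDerivAt (fun θ : ℝ => G (θ • v' + (1 - θ) • v, ‖θ • v' + (1 - θ) • v‖ ^ 2 / 2))
      (L (v' - v, ⟪θ • v' + (1 - θ) • v, v' - v⟫)) θ := by
  have h1 : HasDerivAt (fun θ : ℝ => θ • v' + (1 - θ) • v) (v' - v) θ := by
    have h := ((hasDerivAt_id θ).smul_const v').add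
      (((hasDerivAt_id θ).const_sub 1).smul_const v)
    have e : (1 : ℝ) • v' + (-1 : ℝ) • v = v' - v := by module
    rw [e] at h
    exact h
  have h2 : HasDerivAt (fun θ : ℝ => ‖θ • v' + (1 - θ) • v‖ ^ 2 / 2)
      ⟪θ • v' + (1 - θ) • v, v' - v⟫ θ := by
    have h := h1.norm_sq.div_const 2
    rw [mul_div_cancel_left₀ _ (two_ne_zero)] at h
    exact h
  exact HasFDerivAt.comp_hasDerivAt
    (f := fun θ : ℝ => (θ • v' + (1 - θ) • v, ‖θ • v' + (1 - θ) • v‖ ^ 2 / 2))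
    θ hG (h1.prodMk h2)

/-- The derivative of the lifted segment. -/
theorem hasDerivAt_lift_segment {n : ℕ} (F : Vp n → ℝ) (hF : ContDiff ℝ 1 F)
    (v v' : V n) (θ : ℝ) :
    HasDerivAt (fun θ : ℝ => F (lift (θ • v' + (1 - θ) • v)))
      (fderiv ℝ F (lift (θ • v' + (1 - θ) • v))
        (WithLp.toLp 2 (v' - v, ⟪θ • v' + (1 - θ) • v, v' - v⟫) : Vp n)) θ := by
  have hf := (hF.differentiable one_ne_zero (lift (θ • v' + (1 - θ) • v))).hasFDerivAt
  have h4 : HasFDerivAt (fun p : V n × ℝ => F (WithLp.toLp 2 p))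
      ((fderiv ℝ F (lift (θ • v' + (1 - θ) • v))).comp
        (WithLp.prodContinuousLinearEquiv 2 ℝ (V n) ℝ).symm.toContinuousLinearMap)
      (θ • v' + (1 - θ) • v, ‖θ • v' + (1 - θ) • v‖ ^ 2 / 2) :=
    HasFDerivAt.comp (g := F) _ hf
      (WithLp.prodContinuousLinearEquiv 2 ℝ (V n) ℝ).symm.toContinuousLinearMap.hasFDerivAt
  exact hasDerivAt_comp_segment _ _ v v' θ h4

/-- Bound for the speed of the lifted segment. -/
theorem norm_lift_segment_deriv_le {n : ℕ} (v v' vs : V n)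
    (horth : ⟪v - v', v' - vs⟫ = 0) (hclose : ‖v - v'‖ ≤ 1) (θ : ℝ)
    (h0 : 0 ≤ θ) (h1 : θ ≤ 1) :
    ‖(WithLp.toLp 2 (v' - v, ⟪θ • v' + (1 - θ) • v, v' - v⟫) : Vp n)‖ ≤
      2 * Real.sqrt (1 + ‖vs‖ ^ 2) * ‖v - v'‖ := by
  have hin : ⟪θ • v' + (1 - θ) • v, v' - v⟫ = -⟪vs + (1 - θ) • (v - v'), v - v'⟫ := by
    have e1 : θ • v' + (1 - θ) • v = (v' - vs) + (vs + (1 - θ) • (v - v')) := by module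
    rw [e1, ← neg_sub v v', inner_neg_right, inner_add_left, real_inner_comm, horth, zero_add]
  have hb : |⟪θ • v' + (1 - θ) • v, v' - v⟫| ≤ (‖vs‖ + 1) * ‖v - v'‖ := by
    rw [hin, abs_neg]
    refine (abs_real_inner_le_norm _ _).trans ?_
    gcongr
    refine (norm_add_le _ _).trans ?_
    gcongr
    rw [norm_smul, Real.norm_eq_abs, abs_of_nonneg (by linarith)]
    nlinarith [norm_nonneg (v - v')]
  have hsq := sq_le_sq' (by linarith [abs_nonneg ⟪θ • v' + (1 - θ) • v, v' - v⟫]) hb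
  rw [sq_abs] at hsq
  refine le_of_sq_le_sq ?_ (by positivity)
  rw [WithLp.prod_norm_sq_eq_of_L2, mul_pow, mul_pow, Real.sq_sqrt (by positivity)]
  simp only [Real.norm_eq_abs, sq_abs]
  change ‖v' - v‖ ^ 2 + ⟪θ • v' + (1 - θ) • v, v' - v⟫ ^ 2 ≤ _
  rw [norm_sub_rev v' v]
  nlinarith [mul_nonneg (sq_nonneg ‖v - v'‖) (sq_nonneg (‖vs‖ - 1)),
    mul_nonneg (sq_nonneg ‖v - v'‖) (sq_nonneg ‖vs‖), sq_nonneg ‖v - v'‖]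

/-- First-order difference estimate along the paraboloid (inequality (2.6)):
for collisional `v, v'` (i.e. `⟨v-v', v'-v_*⟩ = 0`) with `|v-v'| ≤ 1`,
`|F(v',|v'|²/2) - F(v,|v|²/2)| ≤ 2⟨v_*⟩ |v-v'| ∫₀¹ ‖DF(ζ̃(θ))‖ dθ`. -/
theorem paraboloid_first_order_difference
    (n : ℕ) (hn : 1 ≤ n) (F : Vp n → ℝ) (hF : ContDiff ℝ 1 F)
    (v v' vs : V n) (horth : ⟪v - v', v' - vs⟫ = 0) (hclose : ‖v - v'‖ ≤ 1) :
    |F (lift v') - F (lift v)| ≤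
      2 * Real.sqrt (1 + ‖vs‖ ^ 2) * ‖v - v'‖ *
        ∫ θ in (0:ℝ)..1, ‖fderiv ℝ F (lift (θ • v' + (1 - θ) • v))‖ := by
  have hd : ∀ θ : ℝ, HasDerivAt (fun θ : ℝ => F (lift (θ • v' + (1 - θ) • v)))
      (fderiv ℝ F (lift (θ • v' + (1 - θ) • v))
        (WithLp.toLp 2 (v' - v, ⟪θ • v' + (1 - θ) • v, v' - v⟫) : Vp n)) θ := fun θ =>
    hasDerivAt_lift_segment F hF v v' θ
  have hγ : Continuous (fun θ : ℝ => lift (θ • v' + (1 - θ) • v)) := by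
    have : Continuous (fun θ : ℝ =>
        (θ • v' + (1 - θ) • v, ‖θ • v' + (1 - θ) • v‖ ^ 2 / 2)) := by fun_prop
    exact (WithLp.prodContinuousLinearEquiv 2 ℝ (V n) ℝ).symm.continuous.comp this
  have hDF : Continuous (fun θ : ℝ => fderiv ℝ F (lift (θ • v' + (1 - θ) • v))) :=
    (hF.continuous_fderiv one_ne_zero).comp hγ
  have hg : Continuous (fun θ : ℝ =>
      (WithLp.toLp 2 (v' - v, ⟪θ • v' + (1 - θ) • v, v' - v⟫) : Vp n)) := by
    have : Continuous (fun θ : ℝ => (v' - v, ⟪θ • v' + (1 - θ) • v, v' - v⟫)) := by fun_prop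
    exact (WithLp.prodContinuousLinearEquiv 2 ℝ (V n) ℝ).symm.continuous.comp this
  have hftc := intervalIntegral.integral_eq_sub_of_hasDerivAt (a := 0) (b := 1)
    (fun θ _ => hd θ) ((hDF.clm_apply hg).intervalIntegrable 0 1)
  simp only [one_smul, sub_self, zero_smul, add_zero, sub_zero, zero_add] at hftc
  rw [← hftc, ← intervalIntegral.integral_const_mul, ← Real.norm_eq_abs]
  refine intervalIntegral.norm_integral_le_of_norm_le zero_le_one ?_
    ((continuous_const.mul hDF.norm).intervalIntegrable 0 1)
  refine Filter.Eventually.of_forall fun θ hθ => ?_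
  refine (ContinuousLinearMap.le_opNorm _ _).trans ?_
  rw [mul_comm]
  gcongr
  exact norm_lift_segment_deriv_le v v' vs horth hclose θ hθ.1.le hθ.2
end
end

section
/- Second-order difference estimate along the paraboloid (inequality (2.7) of the paper). Let n ≥ 1 and let F : ℝ^{n+1} → ℝ be twice continuously differentiable. Let v, v', v_* ∈ ℝⁿ satisfy ⟨v − v', v' − v_*⟩ = 0 and |v − v'| ≤ 1. Define ζ(θ) := θ v' + (1−θ) v and ζ̃(θ) := (ζ(θ), |ζ(θ)|²/2) ∈ ℝ^{n+1} for θ ∈ [0,1]. Then | F(v', |v'|²/2) − F(v, |v|²/2) − DF(v, |v|²/2)[(v' − v, ⟨v, v' − v⟩)] | ≤ 5 (1+|v_*|²) · |v − v'|² · ∫₀¹ max( ‖DF(ζ̃(θ))‖, ‖D²F(ζ̃(θ))‖ ) dθ, where ‖DF(x)‖ and ‖D²F(x)‖ are the operator norms of the first and second Fréchet derivatives of F at x, and DF(x)[ξ] denotes the derivative applied to the vector ξ ∈ ℝ^{n+1}. -/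
open Real
open scoped RealInnerProductSpace

noncomputable section

theorem aux_second_order {X : Type*} [NormedAddCommGroup X] [NormedSpace ℝ X]
    (F : X → ℝ) (hF : ContDiff ℝ 2 F) (P W E : X) (K : ℝ)
    (hK : ∀ θ ∈ Set.Icc (0:ℝ) 1, ‖W + (2 * θ) • E‖ ^ 2 + ‖(2:ℝ) • E‖ ≤ K) :
    |F (P + W + E) - F P - fderiv ℝ F P W| ≤
      K * ∫ θ in (0:ℝ)..1, max ‖fderiv ℝ F (P + θ • W + θ ^ 2 • E)‖
            ‖iteratedFDeriv ℝ 2 F (P + θ • W + θ ^ 2 • E)‖ := by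
  set ψ : ℝ → X := fun θ => P + θ • W + θ ^ 2 • E with hψ
  set w : ℝ → X := fun θ => W + (2 * θ) • E with hw
  have hψd : ∀ θ, HasDerivAt ψ (w θ) θ := by
    intro θ
    have h1 : HasDerivAt (fun θ : ℝ => θ • W) ((1:ℝ) • W) θ := (hasDerivAt_id θ).smul_const W
    have h2 : HasDerivAt (fun θ : ℝ => θ ^ 2 • E) ((2 * θ) • E) θ := by
      have := (hasDerivAt_pow 2 θ).smul_const E
      simpa using this
    have := (h1.const_add P).add h2
    rw [one_smul] at this
    exact this
  have hwd : ∀ θ, HasDerivAt w ((2:ℝ) • E) θ := by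
    intro θ
    have h2 : HasDerivAt (fun θ : ℝ => (2 * θ) • E) ((2:ℝ) • E) θ := by
      have := ((hasDerivAt_id θ).const_mul 2).smul_const E
      simpa using this
    exact h2.const_add W
  have hψc : Continuous ψ := by rw [hψ]; fun_prop
  have hwc : Continuous w := by rw [hw]; fun_prop
  have hF1 : ContDiff ℝ 1 (fderiv ℝ F) := hF.fderiv_right (by norm_num)
  have c1 : Continuous (fderiv ℝ F) := hF1.continuous
  have c2 : Continuous (fderiv ℝ (fderiv ℝ F)) := hF1.continuous_fderiv (by norm_num)
  have c3 : Continuous (iteratedFDeriv ℝ 2 F) := hF.continuous_iteratedFDeriv (by norm_num)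
  have hφ : ∀ θ, HasDerivAt (fun t => F (ψ t)) (fderiv ℝ F (ψ θ) (w θ)) θ := fun θ =>
    ((hF.differentiable (by norm_num)) (ψ θ)).hasFDerivAt.comp_hasDerivAt θ (hψd θ)
  set φ2 : ℝ → ℝ := fun θ =>
    fderiv ℝ (fderiv ℝ F) (ψ θ) (w θ) (w θ) + fderiv ℝ F (ψ θ) ((2:ℝ) • E) with hφ2
  have hφ' : ∀ θ, HasDerivAt (fun t => fderiv ℝ F (ψ t) (w t)) (φ2 θ) θ := by
    intro θ
    have h : HasDerivAt (fun t => fderiv ℝ F (ψ t)) (fderiv ℝ (fderiv ℝ F) (ψ θ) (w θ)) θ :=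
      ((hF1.differentiable (by norm_num)) (ψ θ)).hasFDerivAt.comp_hasDerivAt θ (hψd θ)
    exact h.clm_apply (hwd θ)
  have hφ2c : Continuous φ2 :=
    (((c2.comp hψc).clm_apply hwc).clm_apply hwc).add ((c1.comp hψc).clm_apply continuous_const)
  have hG : ∀ θ ∈ Set.uIcc (0:ℝ) 1,
      HasDerivAt (fun t => F (ψ t) + (1 - t) * fderiv ℝ F (ψ t) (w t)) ((1 - θ) * φ2 θ) θ := by
    intro θ _
    have h1 : HasDerivAt (fun t : ℝ => 1 - t) (-1) θ := (hasDerivAt_id θ).const_sub 1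
    have := (hφ θ).add (h1.mul (hφ' θ))
    refine this.congr_deriv ?_
    ring
  have hcont : Continuous fun θ : ℝ => (1 - θ) * φ2 θ := by fun_prop
  have key := intervalIntegral.integral_eq_sub_of_hasDerivAt hG (hcont.intervalIntegrable 0 1)
  have hlhs : F (P + W + E) - F P - fderiv ℝ F P W = ∫ θ in (0:ℝ)..1, (1 - θ) * φ2 θ := by
    rw [key]
    simp [hψ, hw]
    ring
  rw [hlhs, ← Real.norm_eq_abs, ← intervalIntegral.integral_const_mul]
  refine intervalIntegral.norm_integral_le_of_norm_le zero_le_one ?_ ?_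
  · refine Filter.Eventually.of_forall fun θ hθ => ?_
    have hθ' : θ ∈ Set.Icc (0:ℝ) 1 := ⟨hθ.1.le, hθ.2⟩
    set M := max ‖fderiv ℝ F (P + θ • W + θ ^ 2 • E)‖
            ‖iteratedFDeriv ℝ 2 F (P + θ • W + θ ^ 2 • E)‖
    have hM0 : 0 ≤ M := le_max_of_le_left (norm_nonneg _)
    have a1 : ‖fderiv ℝ F (ψ θ) ((2:ℝ) • E)‖ ≤ M * ‖(2:ℝ) • E‖ :=
      (ContinuousLinearMap.le_opNorm _ _).trans
        (mul_le_mul_of_nonneg_right (le_max_left _ _) (norm_nonneg _))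
    have a2 : ‖fderiv ℝ (fderiv ℝ F) (ψ θ) (w θ) (w θ)‖ ≤ M * ‖w θ‖ ^ 2 := by
      have h := (iteratedFDeriv ℝ 2 F (ψ θ)).le_opNorm ![w θ, w θ]
      rw [iteratedFDeriv_two_apply] at h
      simp [Fin.prod_univ_two] at h
      rw [← pow_two] at h
      exact h.trans (mul_le_mul_of_nonneg_right (le_max_right _ _) (by positivity))
    have a3 : ‖φ2 θ‖ ≤ M * K := by
      refine (norm_add_le _ _).trans ((add_le_add a2 a1).trans ?_)
      rw [← mul_add]
      exact mul_le_mul_of_nonneg_left (hK θ hθ') hM0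
    rw [norm_mul, mul_comm K]
    have a4 : ‖1 - θ‖ ≤ 1 := by
      rw [Real.norm_eq_abs, abs_le]; constructor <;> linarith [hθ.1, hθ.2]
    exact (mul_le_of_le_one_left (norm_nonneg _) a4).trans a3
  · apply Continuous.intervalIntegrable
    exact continuous_const.mul ((c1.comp hψc).norm.max (c3.comp hψc).norm)

/-- Second-order difference estimate along the paraboloid (inequality (2.7)):
for collisional `v, v'` with `|v-v'| ≤ 1`, subtracting the derivative of `F` along the
tangent of the lifted segment at `θ = 0` gains a second power of `|v-v'|`. -/
theorem paraboloid_second_order_difference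
    (n : ℕ) (hn : 1 ≤ n) (F : Vp n → ℝ) (hF : ContDiff ℝ 2 F)
    (v v' vs : V n) (horth : ⟪v - v', v' - vs⟫ = 0) (hclose : ‖v - v'‖ ≤ 1) :
    |F (lift v') - F (lift v) -
        fderiv ℝ F (lift v) ((WithLp.equiv 2 (V n × ℝ)).symm (v' - v, ⟪v, v' - v⟫))| ≤
      5 * (1 + ‖vs‖ ^ 2) * ‖v - v'‖ ^ 2 *
        ∫ θ in (0:ℝ)..1,
          max ‖fderiv ℝ F (lift (θ • v' + (1 - θ) • v))‖
            ‖iteratedFDeriv ℝ 2 F (lift (θ • v' + (1 - θ) • v))‖ := by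
  obtain ⟨a, rfl⟩ : ∃ a, v' = v + a := ⟨v' - v, by abel⟩
  have e1 : v - (v + a) = -a := by abel
  have e2 : v + a - v = a := by abel
  rw [e1, norm_neg] at hclose ⊢
  rw [e2]
  set W : Vp n := (WithLp.equiv 2 (V n × ℝ)).symm (a, ⟪v, a⟫) with hW
  set E : Vp n := (WithLp.equiv 2 (V n × ℝ)).symm (0, ‖a‖ ^ 2 / 2) with hE
  have hlift : ∀ θ : ℝ, lift (θ • (v + a) + (1 - θ) • v) = lift v + θ • W + θ ^ 2 • E := by
    intro θ
    have e : θ • (v + a) + (1 - θ) • v = v + θ • a := by module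
    rw [e]
    apply (WithLp.equiv 2 (V n × ℝ)).injective
    ext1
    · simp [lift, hW, hE]
    · simp [lift, hW, hE, norm_add_sq_real, norm_smul, inner_smul_right, mul_pow]
      ring
  have h1 : lift (v + a) = lift v + W + E := by
    have := hlift 1
    simpa using this
  simp_rw [hlift, h1]
  apply aux_second_order F hF
  intro θ hθ
  have n1 : ‖(2:ℝ) • E‖ = ‖a‖ ^ 2 := by
    have : (2:ℝ) • E = WithLp.toLp 2 ((0 : V n), ‖a‖ ^ 2) := by
      apply (WithLp.equiv 2 (V n × ℝ)).injective
      ext1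
      · simp [hE]
      · simp [hE]; ring
    rw [this]
    simp
  have n2 : ‖W + (2 * θ) • E‖ ^ 2 = ‖a‖ ^ 2 + (⟪v, a⟫ + θ * ‖a‖ ^ 2) ^ 2 := by
    rw [WithLp.prod_norm_sq_eq_of_L2]
    simp [hW, hE]
    ring
  have i1 : ⟪v, a⟫ = ⟪vs, a⟫ - ‖a‖ ^ 2 := by
    have : ⟪a, v + a - vs⟫ = 0 := by simpa using horth
    rw [inner_sub_right, inner_add_right, real_inner_self_eq_norm_sq] at this
    rw [real_inner_comm a v, real_inner_comm a vs]
    linarith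
  rw [n1, n2, i1]
  have cs : ⟪vs, a⟫ ^ 2 ≤ ‖vs‖ ^ 2 * ‖a‖ ^ 2 := by
    rw [← mul_pow, ← sq_abs]
    exact pow_le_pow_left₀ (abs_nonneg _) (abs_real_inner_le_norm _ _) 2
  have ha2 : ‖a‖ ^ 2 ≤ 1 := pow_le_one₀ (norm_nonneg _) hclose
  have ht : (1 - θ) ^ 2 ≤ 1 := pow_le_one₀ (by linarith [hθ.2]) (by linarith [hθ.1])
  set s := ‖a‖ ^ 2
  have hs : 0 ≤ s := by positivity
  set r := ‖vs‖ ^ 2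
  have hr : 0 ≤ r := by positivity
  set x := ⟪vs, a⟫
  have b1 : (x - s + θ * s) ^ 2 ≤ 2 * x ^ 2 + 2 * ((1 - θ) ^ 2 * s ^ 2) := by
    nlinarith [sq_nonneg (x + (1 - θ) * s)]
  have b2 : (1 - θ) ^ 2 * s ^ 2 ≤ s := by
    have : (1 - θ) ^ 2 * s ^ 2 ≤ 1 * s ^ 2 := mul_le_mul_of_nonneg_right ht (by positivity)
    nlinarith
  nlinarith [mul_nonneg hr hs]
end
end

section
/- Length comparability under the non-degeneracy assumption (from the proof of the estimate (5.5)). Let n ≥ 1 and R > δ > 0. Suppose v', v̄', v_*, v̄_* ∈ ℝⁿ satisfy |v_*| ≤ R, |v̄_*| ≤ R, |v' − v̄'| ≤ 2, and D := |v' − v_*|²|v̄' − v̄_*|² − ⟨v' − v_*, v̄' − v̄_*⟩² ≥ δ²( |v' − v_*|² + |v̄' − v̄_*|² ). Then |v' − v_*| ≤ δ^{-1}(2R+2)|v̄' − v̄_*| and |v̄' − v̄_*| ≤ δ^{-1}(2R+2)|v' − v_*|. If moreover |v̄_* − v_*| ≥ δ and |v' − v̄'| ≤ δ/2, then |v' −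 v_*| + |v̄' − v̄_*| ≥ δ/2. -/
open Real
open scoped RealInnerProductSpace

noncomputable section

lemma gram_aux {n : ℕ} (a b : V n) (M δ : ℝ) (hδ : 0 < δ) (hM : 0 ≤ M) (hab : ‖a - b‖ ≤ M)
    (hD : δ ^ 2 * (‖a‖ ^ 2 + ‖b‖ ^ 2) ≤ ‖a‖ ^ 2 * ‖b‖ ^ 2 - ⟪a, b⟫ ^ 2) :
    ‖a‖ ≤ δ⁻¹ * M * ‖b‖ := by
  have h1 := norm_sub_sq_real a b
  have h2 : ‖a - b‖ ^ 2 ≤ M ^ 2 := by gcongr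
  have h3 : ‖a - b‖ ^ 2 * ‖b‖ ^ 2 ≤ M ^ 2 * ‖b‖ ^ 2 := by gcongr
  have h4 : (δ * ‖a‖) ^ 2 ≤ (M * ‖b‖) ^ 2 := by
    rw [h1] at h3
    nlinarith [sq_nonneg (⟪a, b⟫ - ‖b‖ ^ 2), sq_nonneg (δ * ‖b‖)]
  have h5 : δ * ‖a‖ ≤ M * ‖b‖ := (sq_le_sq₀ (by positivity) (by positivity)).1 h4
  rw [mul_assoc, inv_mul_eq_div, le_div_iff₀ hδ]
  linarith

/-- Length comparability under the non-degeneracy assumption on the Gram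
determinant `D` of the pair `(v'-v_*, v̄'-v̄_*)` (from the proof of (5.5)). -/
theorem length_comparability
    (n : ℕ) (hn : 1 ≤ n) (R δ : ℝ) (hδ : 0 < δ) (hδR : δ < R)
    (v' vb' vs vbs : V n) (hvs : ‖vs‖ ≤ R) (hvbs : ‖vbs‖ ≤ R)
    (hclose : ‖v' - vb'‖ ≤ 2)
    (hD : δ ^ 2 * (‖v' - vs‖ ^ 2 + ‖vb' - vbs‖ ^ 2) ≤
      ‖v' - vs‖ ^ 2 * ‖vb' - vbs‖ ^ 2 - ⟪v' - vs, vb' - vbs⟫ ^ 2) :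
    ‖v' - vs‖ ≤ δ⁻¹ * (2 * R + 2) * ‖vb' - vbs‖ ∧
    ‖vb' - vbs‖ ≤ δ⁻¹ * (2 * R + 2) * ‖v' - vs‖ ∧
    (δ ≤ ‖vbs - vs‖ → ‖v' - vb'‖ ≤ δ / 2 →
      δ / 2 ≤ ‖v' - vs‖ + ‖vb' - vbs‖) := by
  have hab : ‖(v' - vs) - (vb' - vbs)‖ ≤ 2 * R + 2 := by
    have e : (v' - vs) - (vb' - vbs) = (v' - vb') + (vbs - vs) := by abel
    rw [e]
    have h1 := norm_add_le (v' - vb') (vbs - vs)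
    have h2 := norm_sub_le vbs vs
    linarith
  refine ⟨gram_aux _ _ _ _ hδ (by linarith) hab hD,
    gram_aux _ _ _ _ hδ (by linarith) (by rwa [norm_sub_rev]) ?_, ?_⟩
  · rw [real_inner_comm]
    linarith
  · intro h1 h2
    have e : vbs - vs = ((v' - vs) - (vb' - vbs)) - (v' - vb') := by abel
    have h3 := norm_sub_le ((v' - vs) - (vb' - vbs)) (v' - vb')
    have h4 := norm_sub_le (v' - vs) (vb' - vbs)
    rw [← e] at h3
    linarith
end
end

section
/- Proposition 5.4 (simplifying the geometry). Let n ≥ 1 and R > δ > 0. There exist δ' > 0 and ε > 0 (depending only on δ and R) such that for all v', v̄', v_*, v̄_* ∈ ℝⁿ satisfying |v_*| ≤ R, |v̄_*| ≤ R, |v' − v_*| ≥ δ, |v' − v_*|²|v' − v̄_*|² − ⟨v' − v_*, v' − v̄_*⟩² ≥ δ² |v' − v_*|², and d(v', v̄') ≤ ε, one has |v̄_* − v_*| ≥ δ' and |v' − v_*|²|v̄' − v̄_*|² − ⟨v' − v_*, v̄' − v̄_*⟩² ≥ δ'²( |v' − v_*|² + |v̄' − v̄_*|² ). -/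
open Real
open scoped RealInnerProductSpace

noncomputable section

lemma gram_identity {n : ℕ} (a b : V n) (t : ℝ) :
    ‖a‖ ^ 2 * ‖b - t • a‖ ^ 2 =
      ‖a‖ ^ 2 * ‖b‖ ^ 2 - ⟪a, b⟫ ^ 2 + (⟪a, b⟫ - t * ‖a‖ ^ 2) ^ 2 := by
  rw [norm_sub_sq_real, inner_smul_right, norm_smul, mul_pow, Real.norm_eq_abs, sq_abs,
    real_inner_comm]
  ring

lemma le_norm_of_gram {n : ℕ} (a b : V n) (t δ : ℝ) (ha : 0 < ‖a‖)
    (h : δ ^ 2 * ‖a‖ ^ 2 ≤ ‖a‖ ^ 2 * ‖b‖ ^ 2 - ⟪a, b⟫ ^ 2) :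
    δ ≤ ‖b - t • a‖ := by
  have h1 := gram_identity a b t
  have h2 : ‖a‖ ^ 2 * δ ^ 2 ≤ ‖a‖ ^ 2 * ‖b - t • a‖ ^ 2 := by
    nlinarith [sq_nonneg (⟪a, b⟫ - t * ‖a‖ ^ 2)]
  have h3 := le_of_mul_le_mul_left h2 (by positivity)
  exact le_trans (le_abs_self δ) (by simpa using sq_le_sq.mp h3)

/-- **Proposition 5.4 (simplifying the geometry)**: the tube condition on `v̄_*`
around the line through `v'` and `v_*` implies the non-degeneracy condition for the
Gram determinant of `(v'-v_*, v̄'-v̄_*)`, provided `d(v',v̄')` is small. -/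
theorem simplifying_the_geometry
    (n : ℕ) (hn : 1 ≤ n) (R δ : ℝ) (hδ : 0 < δ) (hδR : δ < R) :
    ∃ δ' : ℝ, 0 < δ' ∧ ∃ ε : ℝ, 0 < ε ∧
      ∀ v' vb' vs vbs : V n, ‖vs‖ ≤ R → ‖vbs‖ ≤ R →
        δ ≤ ‖v' - vs‖ →
        δ ^ 2 * ‖v' - vs‖ ^ 2 ≤
          ‖v' - vs‖ ^ 2 * ‖v' - vbs‖ ^ 2 - ⟪v' - vs, v' - vbs⟫ ^ 2 →
        anisoDist v' vb' ≤ ε →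
        δ' ≤ ‖vbs - vs‖ ∧
        δ' ^ 2 * (‖v' - vs‖ ^ 2 + ‖vb' - vbs‖ ^ 2) ≤
          ‖v' - vs‖ ^ 2 * ‖vb' - vbs‖ ^ 2 - ⟪v' - vs, vb' - vbs⟫ ^ 2 := by
  have hR : 0 < R := hδ.trans hδR
  refine ⟨δ ^ 2 / (10 * R), by positivity, δ / 2, by positivity, ?_⟩
  intro v' vb' vs vbs hvs hvbs ha hG hd
  have he : ‖v' - vb'‖ ≤ δ / 2 := by
    refine le_trans ?_ hd
    unfold anisoDist
    apply Real.le_sqrt_of_sq_le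
    nlinarith [sq_nonneg (‖v'‖ ^ 2 - ‖vb'‖ ^ 2)]
  have ha0 : 0 < ‖v' - vs‖ := hδ.trans_le ha
  have hD : ‖vbs - vs‖ ≤ 2 * R := by
    have := norm_sub_le vbs vs
    linarith
  have hc : ‖vb' - vbs‖ ≤ ‖v' - vs‖ + 2 * R + δ / 2 := by
    have e : vb' - vbs = (v' - vs) - (vbs - vs) - (v' - vb') := by abel
    rw [e]
    have h1 := norm_sub_le ((v' - vs) - (vbs - vs)) (v' - vb')
    have h2 := norm_sub_le (v' - vs) (vbs - vs)
    linarith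
  constructor
  · have h1 := le_norm_of_gram (v' - vs) (v' - vbs) 1 δ ha0 hG
    have e : (v' - vbs) - (1 : ℝ) • (v' - vs) = -(vbs - vs) := by
      rw [one_smul]; abel
    rw [e, norm_neg] at h1
    refine le_trans ?_ h1
    rw [div_le_iff₀ (by positivity)]
    nlinarith
  · set a := v' - vs with haD
    set c := vb' - vbs with hcD
    set t := ⟪a, c⟫ / ‖a‖ ^ 2 with ht
    have h1 := le_norm_of_gram a (v' - vbs) t δ ha0 hG
    have h2 : δ / 2 ≤ ‖c - t • a‖ := by
      have e : v' - vbs - t • a = (c - t • a) + (v' - vb') := by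
        rw [hcD]; abel
      rw [e] at h1
      have := norm_add_le (c - t • a) (v' - vb')
      linarith
    have h3 := gram_identity a c t
    have h4 : ⟪a, c⟫ - t * ‖a‖ ^ 2 = 0 := by
      rw [ht]; field_simp; ring
    rw [h4] at h3
    have h5 : ‖a‖ ^ 2 * (δ / 2) ^ 2 ≤ ‖a‖ ^ 2 * ‖c‖ ^ 2 - ⟪a, c⟫ ^ 2 := by
      have : ‖a‖ ^ 2 * (δ / 2) ^ 2 ≤ ‖a‖ ^ 2 * ‖c - t • a‖ ^ 2 := by gcongr
      linarith
    refine le_trans ?_ h5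
    have h6 : δ * ‖c‖ ≤ 4 * R * ‖a‖ := by nlinarith
    have h7 : (δ * ‖c‖) ^ 2 ≤ (4 * R * ‖a‖) ^ 2 := by gcongr
    have h8 : (δ * ‖a‖) ^ 2 ≤ (R * ‖a‖) ^ 2 := by gcongr
    have h9 : δ ^ 2 * (‖a‖ ^ 2 + ‖c‖ ^ 2) ≤ 25 * R ^ 2 * ‖a‖ ^ 2 := by
      nlinarith [sq_nonneg (R * ‖a‖)]
    have e : (δ ^ 2 / (10 * R)) ^ 2 * (‖a‖ ^ 2 + ‖c‖ ^ 2) =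
        δ ^ 2 * (δ ^ 2 * (‖a‖ ^ 2 + ‖c‖ ^ 2)) / (100 * R ^ 2) := by
      field_simp; ring
    rw [e, div_le_iff₀ (by positivity)]
    calc δ ^ 2 * (δ ^ 2 * (‖a‖ ^ 2 + ‖c‖ ^ 2)) ≤ δ ^ 2 * (25 * R ^ 2 * ‖a‖ ^ 2) := by gcongr
      _ = _ := by ring
end
end

section
/- Proposition 5.5 (lower bound on the good set). Let n ≥ 1 and R > δ > 0. Suppose g : ℝⁿ → [0,∞) is measurable and C̃ > 0 is such that for every affine line ℓ ⊂ ℝⁿ, ∫_{B_R ∖ T_δ(ℓ)} g ≥ C̃, where T_δ(ℓ) := {x ∈ ℝⁿ : dist(x, ℓ) ≤ δ} and B_R is the closed ball of radius R about the origin. Then for every v' ∈ ℝⁿ, ∫_{B_R} ∫_{B_R} 1_{G'(v')}(v_*, v̄_*) · g(v_*) g(v̄_*) dv̄_* dv_* ≥ C̃², where G'(v') := { (v_*, v̄_*) : |v' − v_*| ≥ δ and |v' − v_*|²|v' − v̄_*|² − ⟨v' − v_*, v' − v̄_*⟩² ≥ δ² |v' − v_*|² } (inequality of values in [0,∞]).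 -/
open MeasureTheory Real Set Metric
open scoped ENNReal RealInnerProductSpace

noncomputable section

/-- `T` is a tube of radius `δ` around some affine line of `ℝⁿ`. -/
def IsTube {n : ℕ} (δ : ℝ) (T : Set (V n)) : Prop :=
  ∃ p u : V n, u ≠ 0 ∧ T = {x | Metric.infDist x {y | ∃ t : ℝ, y = p + t • u} ≤ δ}

/-- the good set `G'(v')`: pairs `(v_*, v̄_*)` with `|v'-v_*| ≥ δ` and `v̄_*` outside
the tube of radius `δ` around the line through `v'` and `v_*` (Gram determinant form). -/
def GoodSet {n : ℕ} (δ : ℝ) (v' : V n) : Set (V n × V n) :=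
  {q | δ ≤ ‖v' - q.1‖ ∧
    δ ^ 2 * ‖v' - q.1‖ ^ 2 ≤
      ‖v' - q.1‖ ^ 2 * ‖v' - q.2‖ ^ 2 - ⟪v' - q.1, v' - q.2⟫ ^ 2}

theorem tube_measurable {n : ℕ} {δ : ℝ} {T : Set (V n)} (h : IsTube δ T) : MeasurableSet T := by
  obtain ⟨p, u, _, rfl⟩ := h
  exact (isClosed_le (Metric.continuous_infDist_pt _) continuous_const).measurableSet

theorem gram_bound {n : ℕ} {δ : ℝ} (hδ : 0 < δ) (v' u x : V n) (hu : u ≠ 0)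
    (hx : δ < Metric.infDist x {y | ∃ t : ℝ, y = v' + t • (-u)}) :
    δ ^ 2 * ‖u‖ ^ 2 ≤ ‖u‖ ^ 2 * ‖v' - x‖ ^ 2 - ⟪u, v' - x⟫ ^ 2 := by
  set w := v' - x with hw
  have hu2 : 0 < ‖u‖ ^ 2 := by positivity
  set t := ⟪u, w⟫ / ‖u‖ ^ 2 with ht
  have h1 : δ < dist x (v' + t • (-u)) :=
    hx.trans_le (Metric.infDist_le_dist_of_mem ⟨t, rfl⟩)
  have h2 : dist x (v' + t • (-u)) = ‖w - t • u‖ := by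
    rw [dist_comm, dist_eq_norm]
    congr 1
    rw [hw, smul_neg]
    abel
  rw [h2] at h1
  have h3 : δ ^ 2 ≤ ‖w - t • u‖ ^ 2 := by gcongr
  rw [norm_sub_sq_real, inner_smul_right, norm_smul, mul_pow, Real.norm_eq_abs, sq_abs,
    real_inner_comm] at h3
  have h4 : t * ‖u‖ ^ 2 = ⟪u, w⟫ := by rw [ht]; field_simp
  have h5 := mul_le_mul_of_nonneg_right h3 hu2.le
  rw [← h4] at h5 ⊢
  nlinarith

/-- **Proposition 5.5 (lower bound on the good set)**. -/
theorem lower_bound_good_set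
    (n : ℕ) (hn : 1 ≤ n) (R δ : ℝ) (hδ : 0 < δ) (hδR : δ < R)
    (g : V n → ℝ) (hmeas : Measurable g) (hpos : ∀ v, 0 ≤ g v)
    (Ct : ℝ) (hCt : 0 < Ct)
    (hL : ∀ T : Set (V n), IsTube δ T →
      ENNReal.ofReal Ct ≤
        ∫⁻ x in Metric.closedBall (0 : V n) R \ T, ENNReal.ofReal (g x)) :
    ∀ v' : V n,
      ENNReal.ofReal (Ct ^ 2) ≤
        ∫⁻ vs in Metric.closedBall (0 : V n) R,
          ∫⁻ vbs in Metric.closedBall (0 : V n) R,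
            Set.indicator (GoodSet δ v')
              (fun q => ENNReal.ofReal (g q.1 * g q.2)) (vs, vbs) := by
  intro v'
  obtain ⟨u₀, hu₀⟩ : ∃ u : V n, u ≠ 0 :=
    ⟨EuclideanSpace.single ⟨0, hn⟩ 1, by simp⟩
  set T₀ : Set (V n) := {x | Metric.infDist x {y | ∃ t : ℝ, y = v' + t • u₀} ≤ δ} with hT₀
  have hT₀t : IsTube δ T₀ := ⟨v', u₀, hu₀, rfl⟩
  have hm := hmeas.ennreal_ofReal
  have hin : ∀ vs ∈ Metric.closedBall (0 : V n) R \ T₀,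
      ENNReal.ofReal (g vs) * ENNReal.ofReal Ct ≤
        ∫⁻ vbs in Metric.closedBall (0 : V n) R,
            Set.indicator (GoodSet δ v')
              (fun q => ENNReal.ofReal (g q.1 * g q.2)) (vs, vbs) := by
    intro vs hvs
    have h1 : δ < Metric.infDist vs {y | ∃ t : ℝ, y = v' + t • u₀} := not_le.1 hvs.2
    have h2 : δ < ‖v' - vs‖ := by
      rw [← dist_eq_norm, dist_comm]
      exact h1.trans_le (Metric.infDist_le_dist_of_mem ⟨0, by simp⟩)
    have hu : v' - vs ≠ 0 := norm_pos_iff.1 (hδ.trans h2)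
    have hT : IsTube δ {x | Metric.infDist x {y | ∃ t : ℝ, y = v' + t • (-(v' - vs))} ≤ δ} :=
      ⟨v', _, neg_ne_zero.2 hu, rfl⟩
    calc ENNReal.ofReal (g vs) * ENNReal.ofReal Ct
        ≤ ENNReal.ofReal (g vs) * _ := mul_le_mul_right (hL _ hT) _
      _ = _ := (lintegral_const_mul _ hm).symm
      _ ≤ _ := setLIntegral_mono' (Metric.isClosed_closedBall.measurableSet.diff
            (tube_measurable hT)) (fun x hx => ?_)
      _ ≤ _ := lintegral_mono_set Set.diff_subset
    rw [Set.indicator_of_mem (show (vs, x) ∈ GoodSet δ v' from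
      ⟨h2.le, gram_bound hδ v' (v' - vs) x hu (not_le.1 hx.2)⟩), ENNReal.ofReal_mul (hpos vs)]
  calc ENNReal.ofReal (Ct ^ 2) = ENNReal.ofReal Ct * ENNReal.ofReal Ct := by
        rw [sq, ENNReal.ofReal_mul hCt.le]
    _ ≤ _ * ENNReal.ofReal Ct := mul_le_mul_left (hL _ hT₀t) _
    _ = _ := (lintegral_mul_const _ hm).symm
    _ ≤ _ := setLIntegral_mono' (Metric.isClosed_closedBall.measurableSet.diff
            (tube_measurable hT₀t)) hin
    _ ≤ _ := lintegral_mono_set Set.diff_subset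
end
end

section
/- The co-plane foot point and its quantitative distance bound (from the proof of Lemma 5.2). Let n ≥ 1 and let v', v̄', v_*, v̄_* ∈ ℝⁿ. Set u := v' − v_*, ū := v̄' − v̄_*, and D := ‖u‖²‖ū‖² − ⟨u,ū⟩², and assume D > 0. Define w := v' + (⟨v̄' − v', ū⟩ / D) · ( ‖u‖² ū − ⟨u, ū⟩ u ). Then: (a) ⟨w − v', u⟩ = 0 and ⟨w − v̄', ū⟩ = 0, i.e. w lies in the co-plane determined by (v', v_*) and (v̄', v̄_*); (b) |w − v'|² = ‖u‖² ⟨v̄' − v', ū⟩² / D; and (c) if in addition d(v', v̄') ≤ 1 and D ≥ δ²‖u‖² for some δ > 0, then |w − v'| ≤ 2 √(1+|v̄_*|²) δ^{-1} d(v', v̄'). -/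
open Real
open scoped RealInnerProductSpace

noncomputable section

theorem foot_aux {n : ℕ} (u b x : V n) (hD : 0 < ‖u‖ ^ 2 * ‖b‖ ^ 2 - ⟪u, b⟫ ^ 2) :
    ⟪(⟪x, b⟫ / (‖u‖ ^ 2 * ‖b‖ ^ 2 - ⟪u, b⟫ ^ 2)) • (‖u‖ ^ 2 • b - ⟪u, b⟫ • u), u⟫ = 0 ∧
    ⟪(⟪x, b⟫ / (‖u‖ ^ 2 * ‖b‖ ^ 2 - ⟪u, b⟫ ^ 2)) • (‖u‖ ^ 2 • b - ⟪u, b⟫ • u), b⟫ = ⟪x, b⟫ ∧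
    ‖(⟪x, b⟫ / (‖u‖ ^ 2 * ‖b‖ ^ 2 - ⟪u, b⟫ ^ 2)) • (‖u‖ ^ 2 • b - ⟪u, b⟫ • u)‖ ^ 2 =
      ‖u‖ ^ 2 * ⟪x, b⟫ ^ 2 / (‖u‖ ^ 2 * ‖b‖ ^ 2 - ⟪u, b⟫ ^ 2) := by
  have h1 : ⟪‖u‖ ^ 2 • b - ⟪u, b⟫ • u, u⟫ = 0 := by
    rw [inner_sub_left, real_inner_smul_left, real_inner_smul_left,
      real_inner_self_eq_norm_sq, real_inner_comm u b]
    ring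
  have h2 : ⟪‖u‖ ^ 2 • b - ⟪u, b⟫ • u, b⟫ = ‖u‖ ^ 2 * ‖b‖ ^ 2 - ⟪u, b⟫ ^ 2 := by
    rw [inner_sub_left, real_inner_smul_left, real_inner_smul_left,
      real_inner_self_eq_norm_sq]
    ring
  have h3 : ‖‖u‖ ^ 2 • b - ⟪u, b⟫ • u‖ ^ 2 =
      ‖u‖ ^ 2 * (‖u‖ ^ 2 * ‖b‖ ^ 2 - ⟪u, b⟫ ^ 2) := by
    rw [← real_inner_self_eq_norm_sq (‖u‖ ^ 2 • b - ⟪u, b⟫ • u)]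
    conv_lhs => rw [inner_sub_right, real_inner_smul_right, real_inner_smul_right, h1, h2]
    ring
  refine ⟨?_, ?_, ?_⟩
  · rw [real_inner_smul_left, h1, mul_zero]
  · rw [real_inner_smul_left, h2, div_mul_cancel₀ _ hD.ne']
  · rw [norm_smul, mul_pow, h3, Real.norm_eq_abs, sq_abs]
    field_simp

theorem inner_bound {n : ℕ} (p q s : V n) (h : anisoDist p q ≤ 1) :
    |⟪q - p, q - s⟫| ≤ 2 * Real.sqrt (1 + ‖s‖ ^ 2) * anisoDist p q := by
  have hd0 : 0 ≤ anisoDist p q := Real.sqrt_nonneg _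
  have hd2 : anisoDist p q ^ 2 = ‖p - q‖ ^ 2 + 4⁻¹ * (‖p‖ ^ 2 - ‖q‖ ^ 2) ^ 2 :=
    Real.sq_sqrt (by positivity)
  have hS2 : Real.sqrt (1 + ‖s‖ ^ 2) ^ 2 = 1 + ‖s‖ ^ 2 := Real.sq_sqrt (by positivity)
  have hS1 : 1 ≤ Real.sqrt (1 + ‖s‖ ^ 2) := by
    rw [Real.one_le_sqrt]; nlinarith [sq_nonneg ‖s‖]
  rw [norm_sub_rev] at hd2
  have hcs : ⟪q - p, s⟫ ^ 2 ≤ ‖q - p‖ ^ 2 * ‖s‖ ^ 2 := by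
    rw [← mul_pow, ← sq_abs ⟪q - p, s⟫]
    exact pow_le_pow_left₀ (abs_nonneg _) (abs_real_inner_le_norm _ _) 2
  have hcs' := abs_real_inner_le_norm (q - p) s
  have hq : ⟪q - p, q⟫ = ‖q - p‖ ^ 2 / 2 + (‖q‖ ^ 2 - ‖p‖ ^ 2) / 2 := by
    rw [norm_sub_sq_real, inner_sub_left, real_inner_self_eq_norm_sq, real_inner_comm q p]
    ring
  rw [inner_sub_right, hq]
  generalize anisoDist p q = d at *
  generalize Real.sqrt (1 + ‖s‖ ^ 2) = S at *
  generalize ⟪q - p, s⟫ = m at *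
  obtain ⟨E, hE⟩ : ∃ E, E = (‖q‖ ^ 2 - ‖p‖ ^ 2) / 2 := ⟨_, rfl⟩
  have hd3 : d ^ 2 = ‖q - p‖ ^ 2 + E ^ 2 := by rw [hd2, hE]; ring
  rw [← hE]
  have hx : 0 ≤ ‖q - p‖ := norm_nonneg _
  have hs : 0 ≤ ‖s‖ := norm_nonneg _
  generalize ‖q - p‖ = x at *
  generalize ‖s‖ = t at *
  have key : |E - m| ≤ S * d := by
    refine abs_le_of_sq_le_sq ?_ (by positivity)
    have h1 : |E - m| ≤ |E| + x * t := (abs_sub E m).trans (by linarith)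
    have h2 : (E - m) ^ 2 ≤ (|E| + x * t) ^ 2 := by
      rw [← sq_abs (E - m)]; exact pow_le_pow_left₀ (abs_nonneg _) h1 2
    rw [mul_pow, hS2, hd3]
    nlinarith [sq_nonneg (|E| * t - x), sq_abs E]
  have hx2 : x ^ 2 ≤ d := by nlinarith [sq_nonneg E]
  have hSd : d ≤ S * d := le_mul_of_one_le_left hd0 hS1
  rw [abs_le] at key ⊢
  constructor <;> nlinarith [key.1, key.2, sq_nonneg x]

/-- The co-plane foot point and its quantitative distance bound
(from the proof of Lemma 5.2). -/
theorem coplane_foot_point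
    (n : ℕ) (hn : 1 ≤ n) (v' vb' vs vbs : V n)
    (hD : 0 < ‖v' - vs‖ ^ 2 * ‖vb' - vbs‖ ^ 2 - ⟪v' - vs, vb' - vbs⟫ ^ 2) :
    ⟪(v' + ((⟪vb' - v', vb' - vbs⟫ /
          (‖v' - vs‖ ^ 2 * ‖vb' - vbs‖ ^ 2 - ⟪v' - vs, vb' - vbs⟫ ^ 2)) •
          (‖v' - vs‖ ^ 2 • (vb' - vbs) - ⟪v' - vs, vb' - vbs⟫ • (v' - vs)))) - v',
        v' - vs⟫ = 0 ∧
    ⟪(v' + ((⟪vb' - v', vb' - vbs⟫ /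
          (‖v' - vs‖ ^ 2 * ‖vb' - vbs‖ ^ 2 - ⟪v' - vs, vb' - vbs⟫ ^ 2)) •
          (‖v' - vs‖ ^ 2 • (vb' - vbs) - ⟪v' - vs, vb' - vbs⟫ • (v' - vs)))) - vb',
        vb' - vbs⟫ = 0 ∧
    ‖(v' + ((⟪vb' - v', vb' - vbs⟫ /
          (‖v' - vs‖ ^ 2 * ‖vb' - vbs‖ ^ 2 - ⟪v' - vs, vb' - vbs⟫ ^ 2)) •
          (‖v' - vs‖ ^ 2 • (vb' - vbs) - ⟪v' - vs, vb' - vbs⟫ • (v' - vs)))) - v'‖ ^ 2 =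
      ‖v' - vs‖ ^ 2 * ⟪vb' - v', vb' - vbs⟫ ^ 2 /
        (‖v' - vs‖ ^ 2 * ‖vb' - vbs‖ ^ 2 - ⟪v' - vs, vb' - vbs⟫ ^ 2) ∧
    (∀ δ : ℝ, 0 < δ → anisoDist v' vb' ≤ 1 →
      δ ^ 2 * ‖v' - vs‖ ^ 2 ≤
        ‖v' - vs‖ ^ 2 * ‖vb' - vbs‖ ^ 2 - ⟪v' - vs, vb' - vbs⟫ ^ 2 →
      ‖(v' + ((⟪vb' - v', vb' - vbs⟫ /
            (‖v' - vs‖ ^ 2 * ‖vb' - vbs‖ ^ 2 - ⟪v' - vs, vb' - vbs⟫ ^ 2)) •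
            (‖v' - vs‖ ^ 2 • (vb' - vbs) - ⟪v' - vs, vb' - vbs⟫ • (v' - vs)))) - v'‖ ≤
        2 * Real.sqrt (1 + ‖vbs‖ ^ 2) * δ⁻¹ * anisoDist v' vb') := by
  obtain ⟨h1, h2, h3⟩ := foot_aux (v' - vs) (vb' - vbs) (vb' - v') hD
  have hb := inner_bound v' vb' vbs
  rw [add_sub_cancel_left, add_sub_right_comm]
  refine ⟨h1, ?_, h3, ?_⟩
  · rw [inner_add_left, h2, ← inner_add_left]
    simp
  · intro δ hδ hd hδD
    have hb := hb hd
    have hd0 : 0 ≤ anisoDist v' vb' := Real.sqrt_nonneg _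
    refine (sq_le_sq₀ (norm_nonneg _) (by positivity)).1 ?_
    rw [h3, div_le_iff₀ hD]
    have e : 2 * Real.sqrt (1 + ‖vbs‖ ^ 2) * δ⁻¹ * anisoDist v' vb' =
      (2 * Real.sqrt (1 + ‖vbs‖ ^ 2) * anisoDist v' vb') * δ⁻¹ := by ring
    rw [e]
    have hb2 := pow_le_pow_left₀ (abs_nonneg _) hb 2
    rw [sq_abs] at hb2
    generalize 2 * Real.sqrt (1 + ‖vbs‖ ^ 2) * anisoDist v' vb' = B at *
    calc _ ≤ ‖v' - vs‖ ^ 2 * B ^ 2 := by gcongr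
      _ = (B * δ⁻¹) ^ 2 * (δ ^ 2 * ‖v' - vs‖ ^ 2) := by field_simp
      _ ≤ _ := by gcongr
end
end

section
/- Midpoint contraction for the anisotropic metric (from Section 5.4). Let n ≥ 1 and let v, v' ∈ ℝⁿ satisfy d(v, v') ≤ 1, where d(v,v') := √(|v-v'|² + ¼(|v|²-|v'|²)²). Then d( v, (v+v')/2 ) ≤ (3/4) d(v, v') and d( v', (v+v')/2 ) ≤ (3/4) d(v, v'). -/
open Real

noncomputable section

lemma aniso_aux {n : ℕ} (v v' : V n) (h : anisoDist v v' ≤ 1) :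
    anisoDist v ((2:ℝ)⁻¹ • (v + v')) ≤ (3 / 4) * anisoDist v v' := by
  unfold anisoDist at *
  have h1 : v - (2:ℝ)⁻¹ • (v + v') = (2:ℝ)⁻¹ • (v - v') := by module
  have h2 : ‖v - (2:ℝ)⁻¹ • (v + v')‖ ^ 2 = ‖v - v'‖ ^ 2 / 4 := by
    rw [h1, norm_smul, mul_pow]; norm_num; ring
  have h3 : ‖(2:ℝ)⁻¹ • (v + v')‖ ^ 2 = (‖v‖ ^ 2 + ‖v'‖ ^ 2) / 2 - ‖v - v'‖ ^ 2 / 4 := by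
    rw [norm_smul, mul_pow, norm_add_sq_real, norm_sub_sq_real]; norm_num; ring
  rw [h2, h3]
  have hD : 0 ≤ ‖v - v'‖ ^ 2 := by positivity
  generalize ‖v - v'‖ ^ 2 = D at *
  generalize ‖v‖ ^ 2 = a at *
  generalize ‖v'‖ ^ 2 = b at *
  have h := (Real.sqrt_le_iff.1 h).2
  apply Real.sqrt_le_iff.2
  refine ⟨by positivity, ?_⟩
  rw [mul_pow, Real.sq_sqrt (by positivity)]
  have hS : a - b ≤ 2 := by nlinarith
  have hD1 : D ≤ 1 := by nlinarith [sq_nonneg (a - b)]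
  nlinarith [mul_nonneg hD (sub_nonneg.2 hS), mul_nonneg hD (sub_nonneg.2 hD1),
    sq_nonneg (a - b)]

lemma aniso_symm {n : ℕ} (v v' : V n) : anisoDist v v' = anisoDist v' v := by
  unfold anisoDist
  rw [norm_sub_rev]
  congr 1
  ring

/-- Midpoint contraction for the anisotropic metric (from Section 5.4). -/
theorem midpoint_contraction
    (n : ℕ) (hn : 1 ≤ n) (v v' : V n) (h : anisoDist v v' ≤ 1) :
    anisoDist v ((2:ℝ)⁻¹ • (v + v')) ≤ (3 / 4) * anisoDist v v' ∧
    anisoDist v' ((2:ℝ)⁻¹ • (v + v')) ≤ (3 / 4) * anisoDist v v' := by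
  refine ⟨aniso_aux v v' h, ?_⟩
  rw [aniso_symm v v'] at h ⊢
  rw [add_comm]
  exact aniso_aux v' v h
end
end
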